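/- arXiv:2601.09517 — 3 statements merged into one kernel-verified Lean document; each statement's English description precedes it below -/
import Mathlib

section
/- Let L = ℚ(√d) be a real quadratic field (d ≥ 2 squarefree) with fundamental unit η > 1, let k ∈ ℕ and ρ = ⌊k/2⌋, and set c_k = 1/ρ! if k is even and c_k = 3/ρ! if k is odd. For X ≥ 2, let N_{L,k}(X) denote the number of integers n with |n| ≤ X that can be written as n = u_1 + ⋯ + u_r for some 0 ≤ r ≤ k and units u_1, …, u_r of the ring of integers O_L (the empty sum r = 0 representing n = 0). Then N_{L,k}(X) = c_k·(2 log X / log η)^ρ + O_{k,L}((log X)^{ρ−1}). -/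
open NumberField IntermediateField

/-- The real embedding of the ring of integers of a subfield of `ℝ`. -/
noncomputable def emb (L : IntermediateField ℚ ℝ) (x : 𝓞 L) : ℝ := ((x : L) : ℝ)

/-- The properties of the ring of integers of a real quadratic field used for counting sums of
units: a real embedding `φ`, the conjugation `σ`, a fundamental unit `η`, and the exponent `ex u`
of a unit `u = ± η ^ ex u`. -/
structure RealQuadraticUnits (R : Type*) [CommRing R] where
  φ : R →+* ℝ
  σ : R →+* R
  η : Rˣ
  ex : Rˣ → ℤ
  σ_σ : ∀ x, σ (σ x) = x
  one_le_norm : ∀ x, x ≠ 0 → 1 ≤ |φ x| * |φ (σ x)|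
  exists_trace : ∀ x, ∃ m : ℤ, x + σ x = m
  one_lt : 1 < φ η
  abs_unit : ∀ u : Rˣ, |φ u| = φ η ^ ex u

theorem finrank_adjoin_sqrt (d : ℕ) (hd : 2 ≤ d) (hsf : Squarefree d) :
    Module.finrank ℚ ℚ⟮(Real.sqrt d)⟯ = 2 := by
  have hsq : Real.sqrt d ^ 2 = d := Real.sq_sqrt (Nat.cast_nonneg d)
  have hirr : Irrational (Real.sqrt d) := by
    rw [irrational_sqrt_natCast_iff]
    rintro ⟨m, rfl⟩
    have := hsf m dvd_rfl
    rw [Nat.isUnit_iff] at this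
    subst this
    omega
  have hroot : Polynomial.aeval (Real.sqrt d)
      (Polynomial.X ^ 2 - Polynomial.C (d : ℚ)) = 0 := by
    simp [hsq]
  have hmonic : (Polynomial.X ^ 2 - Polynomial.C (d : ℚ)).Monic :=
    Polynomial.monic_X_pow_sub_C _ two_ne_zero
  have hint : IsIntegral ℚ (Real.sqrt d) := ⟨_, hmonic, hroot⟩
  rw [IntermediateField.adjoin.finrank hint]
  apply le_antisymm
  · refine (Polynomial.natDegree_le_of_dvd (minpoly.dvd _ _ hroot) hmonic.ne_zero).trans ?_
    exact (Polynomial.natDegree_X_pow_sub_C).le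
  · rw [minpoly.two_le_natDegree_iff hint]
    rintro ⟨q, hq⟩
    exact hirr ⟨q, hq⟩

theorem exists_conjugation (L : IntermediateField ℚ ℝ) (h2 : Module.finrank ℚ L = 2) :
    ∃ σ : 𝓞 L →+* 𝓞 L, (∀ x, σ (σ x) = x) ∧ (∀ x, ∃ m : ℤ, x + σ x = m) ∧
      ∀ x, ∃ m : ℤ, x * σ x = m := by
  classical
  have : Algebra.IsQuadraticExtension ℚ L := { finrank_eq_two' := h2 }
  have : FiniteDimensional ℚ L := Module.finite_of_finrank_eq_succ h2
  have hcard : Nat.card Gal(L/ℚ) = 2 := (IsGalois.card_aut_eq_finrank ℚ L).trans h2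
  obtain ⟨τ, hτ, huniv⟩ : ∃ τ : Gal(L/ℚ), 1 ≠ τ ∧ (Finset.univ : Finset Gal(L/ℚ)) = {1, τ} := by
    rw [Nat.card_eq_fintype_card, ← Finset.card_univ, Finset.card_eq_two] at hcard
    obtain ⟨a, b, hab, h⟩ := hcard
    have h1 : (1 : Gal(L/ℚ)) ∈ ({a, b} : Finset _) := h ▸ Finset.mem_univ _
    simp only [Finset.mem_insert, Finset.mem_singleton] at h1
    rcases h1 with rfl | rfl
    · exact ⟨b, hab, h⟩
    · exact ⟨a, hab.symm, by rw [h, Finset.pair_comm]⟩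
  have hsum (x : L) : algebraMap ℚ L (Algebra.trace ℚ L x) = x + τ x := by
    rw [trace_eq_sum_automorphisms, huniv, Finset.sum_pair hτ]; rfl
  have hprod (x : L) : algebraMap ℚ L (Algebra.norm ℚ x) = x * τ x := by
    rw [Algebra.norm_eq_prod_automorphisms, huniv, Finset.prod_pair hτ]; rfl
  have hττ (x : L) : τ (τ x) = x := by
    have h1 : τ * τ ∈ ({1, τ} : Finset _) := huniv ▸ Finset.mem_univ _
    simp only [Finset.mem_insert, Finset.mem_singleton, mul_eq_right] at h1
    rcases h1 with h1 | h1
    · exact DFunLike.congr_fun h1 x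
    · exact absurd h1.symm hτ
  refine ⟨RingOfIntegers.mapRingHom (τ : L →+* L), fun x => ?_, fun x => ?_, fun x => ?_⟩
  · ext
    simp [hττ]
  · obtain ⟨m, hm⟩ := IsIntegrallyClosed.isIntegral_iff.1
      (Algebra.isIntegral_trace (L := ℚ) x.isIntegral_coe)
    refine ⟨m, RingOfIntegers.ext ?_⟩
    have := hsum x
    rw [← hm] at this
    simpa using this.symm
  · obtain ⟨m, hm⟩ := IsIntegrallyClosed.isIntegral_iff.1
      (Algebra.isIntegral_norm ℚ x.isIntegral_coe)
    refine ⟨m, RingOfIntegers.ext ?_⟩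
    have := hprod x
    rw [← hm] at this
    simpa using this.symm

theorem map_units_zpow {R K : Type*} [CommRing R] [Field K] (φ : R →+* K) (u : Rˣ) (n : ℤ) :
    φ ((u ^ n : Rˣ) : R) = φ u ^ n := by
  have := congrArg Units.val (map_zpow (Units.map (φ : R →* K)) u n)
  rwa [Units.val_zpow_eq_zpow_val] at this

theorem exists_realQuadraticUnits (L : IntermediateField ℚ ℝ) (h2 : Module.finrank ℚ L = 2)
    (η : (𝓞 L)ˣ) (hη : 1 < emb L η)
    (hfund : ∀ ε : (𝓞 L)ˣ, 1 < emb L ε → emb L η ≤ emb L ε) :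
    ∃ S : RealQuadraticUnits (𝓞 L), S.φ S.η = emb L η := by
  obtain ⟨σ, hσ, htr, hnorm⟩ := exists_conjugation L h2
  let φ : 𝓞 L →+* ℝ := (algebraMap L ℝ).comp (algebraMap (𝓞 L) L)
  have hφ : Function.Injective φ :=
    (algebraMap L ℝ).injective.comp RingOfIntegers.coe_injective
  have hφe (x : 𝓞 L) : φ x = emb L x := rfl
  have hη0 : 0 < φ η := zero_lt_one.trans hη
  have hpow := map_units_zpow φ η
  have hex (u : (𝓞 L)ˣ) : ∃ n : ℤ, |φ u| = φ η ^ n := by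
    have hu : 0 < |φ u| := abs_pos.2 ((map_ne_zero_iff φ hφ).2 u.ne_zero)
    obtain ⟨n, hn, hn'⟩ := exists_mem_Ico_zpow hu hη
    refine ⟨n, le_antisymm ?_ hn⟩
    have hpos : 0 < φ η ^ n := zpow_pos hη0 n
    by_contra! hlt
    obtain ⟨v, hv⟩ : ∃ v : (𝓞 L)ˣ, φ v = |φ u| / φ η ^ n := by
      rcases abs_choice (φ u) with h | h
      · exact ⟨u * η ^ (-n), by
          rw [Units.val_mul, map_mul, hpow, h, zpow_neg, div_eq_mul_inv]⟩
      · exact ⟨-u * η ^ (-n), by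
          rw [Units.val_mul, map_mul, hpow, h, zpow_neg, div_eq_mul_inv, Units.val_neg, map_neg]⟩
    have h1 : 1 < emb L v := by
      rw [← hφe, hv, one_lt_div hpos]; exact hlt
    have h3 := hfund v h1
    rw [← hφe, ← hφe, hv, le_div_iff₀ hpos] at h3
    rw [← hφe, zpow_add_one₀ hη0.ne'] at hn'
    linarith [mul_comm (φ η) (φ η ^ n)]
  choose ex hex using hex
  refine ⟨⟨φ, σ, η, ex, hσ, fun x hx => ?_, htr, hη, hex⟩, rfl⟩
  obtain ⟨m, hm⟩ := hnorm x
  rw [← abs_mul, ← map_mul, hm, map_intCast, ← Int.cast_abs]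
  have hσ0 : σ x ≠ 0 := fun h => hx (by rw [← hσ x, h, map_zero])
  have : m ≠ 0 := by
    rintro rfl
    simp [hx, hσ0] at hm
  exact_mod_cast Int.one_le_abs this

namespace RealQuadraticUnits

variable {R : Type*} [CommRing R] (S : RealQuadraticUnits R)

/-- The sum of a multiset of units. -/
def unitSum (s : Multiset Rˣ) : R := (s.map Units.val).sum

@[simp] theorem unitSum_zero : unitSum (0 : Multiset Rˣ) = 0 := rfl

@[simp] theorem unitSum_cons (u : Rˣ) (s : Multiset Rˣ) : unitSum (u ::ₘ s) = u + unitSum s := by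
  simp [unitSum]

@[simp] theorem unitSum_singleton (u : Rˣ) : unitSum {u} = (u : R) := by
  simp [unitSum]

@[simp] theorem unitSum_add (s t : Multiset Rˣ) :
    unitSum (s + t) = unitSum s + unitSum t := by
  simp [unitSum]

theorem abs_map_unitSum_le (f : R →+* ℝ) (s : Multiset Rˣ) (B : ℝ)
    (h : ∀ u ∈ s, |f u| ≤ B) : |f (unitSum s)| ≤ s.card * B := by
  induction s using Multiset.induction with
  | empty => simp
  | cons u s ih =>
    have h1 := ih fun v hv => h v (Multiset.mem_cons_of_mem hv)
    have h2 := h u (Multiset.mem_cons_self u s)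
    have h3 := abs_add_le (f u) (f (unitSum s))
    rw [unitSum_cons, map_add, Multiset.card_cons]
    push_cast
    linarith

theorem φ_η_pos : 0 < S.φ S.η := zero_lt_one.trans S.one_lt

theorem φ_injective : Function.Injective S.φ := by
  rw [injective_iff_map_eq_zero]
  intro x hx
  by_contra h
  have := S.one_le_norm x h
  rw [hx, abs_zero, zero_mul] at this
  linarith

theorem σ_injective : Function.Injective S.σ :=
  Function.LeftInverse.injective S.σ_σ

include S in
theorem intCast_injective : Function.Injective (Int.cast : ℤ → R) := by
  intro a b h
  have := congrArg S.φ h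
  simpa using this

theorem zpow_le {a b : ℤ} (h : a ≤ b) : S.φ S.η ^ a ≤ S.φ S.η ^ b :=
  zpow_le_zpow_right₀ S.one_lt.le h

include S in
theorem units_ne_zero (u : Rˣ) : (u : R) ≠ 0 := fun h => by
  have h1 := u.mul_inv
  rw [h, zero_mul] at h1
  have := congrArg S.φ h1
  simp at this

theorem abs_unit_mul_conj (u : Rˣ) : |S.φ u| * |S.φ (S.σ u)| = 1 := by
  have h1 := S.one_le_norm u (S.units_ne_zero u)
  have h2 := S.one_le_norm _ (S.units_ne_zero u⁻¹)
  have h3 : (|S.φ u| * |S.φ (S.σ u)|) *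
      (|S.φ (u⁻¹ : Rˣ)| * |S.φ (S.σ (u⁻¹ : Rˣ))|) = 1 := by
    rw [mul_mul_mul_comm, ← abs_mul, ← abs_mul, ← map_mul, ← map_mul, ← map_mul, u.mul_inv]
    simp
  nlinarith

theorem abs_unit_conj (u : Rˣ) : |S.φ (S.σ u)| = S.φ S.η ^ (-S.ex u) := by
  have h := S.abs_unit_mul_conj u
  rw [S.abs_unit] at h
  rw [zpow_neg]
  exact eq_inv_of_mul_eq_one_right h

theorem ex_eq_of_abs_eq {u : Rˣ} {a : ℤ} (h : |S.φ u| = S.φ S.η ^ a) : S.ex u = a :=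
  zpow_right_injective₀ S.φ_η_pos S.one_lt.ne' ((S.abs_unit u).symm.trans h)

theorem eq_or_eq_neg (u : Rˣ) : u = S.η ^ S.ex u ∨ u = -S.η ^ S.ex u := by
  have h := S.abs_unit u
  rw [← map_units_zpow] at h
  have hpos : 0 < S.φ ((S.η ^ S.ex u : Rˣ) : R) := by
    rw [map_units_zpow]; exact zpow_pos S.φ_η_pos _
  rw [abs_eq hpos.le] at h
  rcases h with h | h
  · exact Or.inl (Units.ext (S.φ_injective h))
  · exact Or.inr (Units.ext (S.φ_injective (by rw [h, Units.val_neg, map_neg])))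

/-- The trace of an element, as an integer. -/
noncomputable def tr (x : R) : ℤ := (S.exists_trace x).choose

theorem add_conj (x : R) : x + S.σ x = S.tr x := (S.exists_trace x).choose_spec

theorem φ_add_conj (x : R) : S.φ x + S.φ (S.σ x) = S.tr x := by
  rw [← map_add, S.add_conj, map_intCast]

/-- The integers that are sums of at most `k` units with exponents in `[-M, M]`. -/
def unitSums (k : ℕ) (M : ℤ) : Set ℤ :=
  {n | ∃ s : Multiset Rˣ, s.card ≤ k ∧ (∀ u ∈ s, |S.ex u| ≤ M) ∧ unitSum s = n}

theorem abs_le_of_mem_unitSums {k : ℕ} {M n : ℤ} (h : n ∈ S.unitSums k M) :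
    |(n : ℝ)| ≤ k * S.φ S.η ^ M := by
  obtain ⟨s, h1, h2, h3⟩ := h
  have := abs_map_unitSum_le S.φ s (S.φ S.η ^ M) fun u hu => by
    rw [S.abs_unit]; exact S.zpow_le ((le_abs_self _).trans (h2 u hu))
  rw [h3, map_intCast] at this
  refine this.trans (mul_le_mul_of_nonneg_right ?_ (zpow_pos S.φ_η_pos _).le)
  exact_mod_cast h1

theorem finite_unitSums (k : ℕ) (M : ℤ) : (S.unitSums k M).Finite := by
  obtain ⟨N, hN⟩ := exists_nat_ge (k * S.φ S.η ^ M)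
  refine (Set.finite_Icc (-(N : ℤ)) N).subset fun n hn => ?_
  rw [Set.mem_Icc, ← abs_le]
  have := (S.abs_le_of_mem_unitSums hn).trans hN
  exact_mod_cast this

theorem finite_bounded_conjugates (B : ℝ) :
    {x : R | |S.φ x| ≤ B ∧ |S.φ (S.σ x)| ≤ B}.Finite := by
  obtain ⟨N, hN⟩ := exists_nat_ge (2 * S.φ S.η * B)
  have h1 := S.one_lt
  have hconj : |S.φ (S.σ S.η)| ≤ 1 := by
    have := S.abs_unit_mul_conj S.η
    rw [abs_of_pos S.φ_η_pos] at this
    nlinarith [abs_nonneg (S.φ (S.σ S.η))]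
  refine Set.Finite.of_finite_image (f := fun x => (S.tr x, S.tr (S.η * x))) ?_ ?_
  · refine ((Set.finite_Icc (-(N : ℤ)) N).prod (Set.finite_Icc (-(N : ℤ)) N)).subset ?_
    rintro _ ⟨x, ⟨hx1, hx2⟩, rfl⟩
    have hB : 0 ≤ B := (abs_nonneg _).trans hx1
    have e1 : |S.φ x + S.φ (S.σ x)| ≤ N := by
      refine (abs_add_le _ _).trans (le_trans ?_ hN)
      nlinarith
    have e2 : |S.φ (S.η * x) + S.φ (S.σ (S.η * x))| ≤ N := by
      refine (abs_add_le _ _).trans (le_trans ?_ hN)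
      rw [map_mul, map_mul, map_mul, abs_mul, abs_mul, abs_of_pos S.φ_η_pos]
      have := mul_le_mul hconj hx2 (abs_nonneg _) zero_le_one
      have := mul_le_mul_of_nonneg_left hx1 S.φ_η_pos.le
      nlinarith
    rw [S.φ_add_conj] at e1 e2
    simp only [Set.mem_prod, Set.mem_Icc, ← abs_le]
    exact ⟨by exact_mod_cast e1, by exact_mod_cast e2⟩
  · intro x _ y _ hxy
    simp only [Prod.mk.injEq] at hxy
    have e1 := S.φ_add_conj x
    have e2 := S.φ_add_conj (S.η * x)
    rw [hxy.1, ← S.φ_add_conj] at e1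
    rw [hxy.2, ← S.φ_add_conj] at e2
    simp only [map_mul] at e2
    apply S.φ_injective
    have : (S.φ S.η - S.φ (S.σ S.η)) * (S.φ x - S.φ y) = 0 := by
      linear_combination e2 - S.φ (S.σ S.η) * e1
    have h3 : S.φ S.η - S.φ (S.σ S.η) ≠ 0 := by
      have := (abs_le.1 hconj).2
      linarith
    exact sub_eq_zero.1 ((mul_eq_zero.1 this).resolve_left h3)

/-- A multiset of at most `k` units with a large exponent splits into three parts separated by
gaps of length `G`. -/
theorem exists_gap (k : ℕ) (G : ℤ) (hG : 1 ≤ G) (s : Multiset Rˣ) (hs : s.card ≤ k)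
    (h : ∃ u ∈ s, (k + 1) * G + 1 ≤ |S.ex u|) :
    ∃ (p m z : Multiset Rˣ) (T : ℤ), s = p + m + z ∧ G ≤ T ∧ (∀ u ∈ p, T < S.ex u) ∧
      (∀ u ∈ m, S.ex u < -T) ∧ (∀ u ∈ z, |S.ex u| ≤ T - G) ∧ z.card < s.card ∧
      ∀ u ∈ s, |S.ex u| ≤ T + k * G + 1 := by
  classical
  obtain ⟨u₁, hu₁, hbig⟩ := h
  obtain ⟨u₀, hu₀, hmax⟩ := Finset.exists_max_image s.toFinset (fun u => |S.ex u|)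
    ⟨u₁, Multiset.mem_toFinset.2 hu₁⟩
  rw [Multiset.mem_toFinset] at hu₀
  have hbig₀ := hbig.trans (hmax u₁ (Multiset.mem_toFinset.2 hu₁))
  set A := |S.ex u₀|
  obtain ⟨j, hj, hj'⟩ : ∃ j ∈ Finset.Icc (0 : ℤ) k,
      j ∉ s.toFinset.image fun u => (A - 1 - |S.ex u|) / G := by
    apply Finset.exists_mem_notMem_of_card_lt_card
    have h1 := Finset.card_image_le (s := s.toFinset) (f := fun u => (A - 1 - |S.ex u|) / G)
    have h2 := s.toFinset_card_le
    rw [Int.card_Icc]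
    omega
  rw [Finset.mem_Icc] at hj
  have hjG : j * G ≤ k * G := mul_le_mul_of_nonneg_right hj.2 (by linarith)
  have hjG0 : 0 ≤ j * G := mul_nonneg hj.1 (by linarith)
  have hgap : ∀ u ∈ s, A - 1 - j * G < |S.ex u| ∨ |S.ex u| ≤ A - 1 - j * G - G := by
    intro u hu
    by_contra! hc
    refine hj' (Finset.mem_image.2 ⟨u, Multiset.mem_toFinset.2 hu, ?_⟩)
    rw [Int.ediv_eq_iff_of_pos (by linarith)]
    constructor <;> nlinarith [hc.1, hc.2]
  have hT : G ≤ A - 1 - j * G := by linarith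
  have hsplit : s = s.filter (fun u => A - 1 - j * G < S.ex u) +
      s.filter (fun u => S.ex u < -(A - 1 - j * G)) +
      s.filter (fun u => |S.ex u| ≤ A - 1 - j * G - G) := by
    conv_lhs => rw [← Multiset.filter_add_not (fun u => |S.ex u| ≤ A - 1 - j * G - G) s]
    rw [add_comm]
    congr 1
    rw [← Multiset.filter_add_not (fun u => A - 1 - j * G < S.ex u)
      (s.filter fun u => ¬ |S.ex u| ≤ A - 1 - j * G - G), Multiset.filter_filter,
      Multiset.filter_filter]
    congr 1 <;> refine Multiset.filter_congr fun u hu => ?_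
    · constructor
      · exact fun h => h.1
      · intro h
        refine ⟨h, ?_⟩
        have := le_abs_self (S.ex u)
        linarith
    · constructor
      · rintro ⟨h1, h2⟩
        rcases hgap u hu with h3 | h3
        · rcases lt_abs.1 h3 with h4 | h4
          · exact absurd h4 h1
          · linarith
        · exact absurd h3 h2
      · intro h
        have := neg_le_abs (S.ex u)
        constructor <;> linarith
  refine ⟨_, _, _, A - 1 - j * G, hsplit, hT, fun u hu => (Multiset.mem_filter.1 hu).2,
    fun u hu => (Multiset.mem_filter.1 hu).2, fun u hu => (Multiset.mem_filter.1 hu).2,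
    ?_, fun u hu => ?_⟩
  · refine Multiset.card_lt_card (lt_of_le_of_ne (Multiset.filter_le _ _) fun h => ?_)
    have := (Multiset.filter_eq_self.1 h) u₀ hu₀
    linarith
  · have := hmax u (Multiset.mem_toFinset.2 hu)
    linarith

section Cluster

variable {k : ℕ} {G T n : ℤ} {p m z : Multiset Rˣ}
  (hG : 0 ≤ G) (hkG : 4 * (k : ℝ) ^ 2 ≤ S.φ S.η ^ G) (hGT : G ≤ T)
  (hcard : p.card + m.card + z.card ≤ k) (hp : ∀ u ∈ p, T < S.ex u)
  (hm : ∀ u ∈ m, S.ex u < -T) (hz : ∀ u ∈ z, |S.ex u| ≤ T - G)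
  (hn : unitSum p + unitSum m + unitSum z = n)
include hG hkG hGT hcard hp hm hz hn

theorem upper_eq_conj_lower : unitSum p = S.σ (unitSum m) := by
  have hq := S.φ_η_pos
  have bσp := abs_map_unitSum_le (S.φ.comp S.σ) p (S.φ S.η ^ (-T)) fun u hu => by
    rw [RingHom.comp_apply, S.abs_unit_conj]
    exact S.zpow_le (by linarith [hp u hu])
  have bm := abs_map_unitSum_le S.φ m (S.φ S.η ^ (-T)) fun u hu => by
    rw [S.abs_unit]
    exact S.zpow_le (by linarith [hm u hu])
  have bz := abs_map_unitSum_le S.φ z (S.φ S.η ^ (T - G)) fun u hu => by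
    rw [S.abs_unit]
    exact S.zpow_le ((le_abs_self _).trans (hz u hu))
  have bσz := abs_map_unitSum_le (S.φ.comp S.σ) z (S.φ S.η ^ (T - G)) fun u hu => by
    rw [RingHom.comp_apply, S.abs_unit_conj]
    exact S.zpow_le ((neg_le_abs _).trans (hz u hu))
  simp only [RingHom.comp_apply] at bσp bσz
  have hle : S.φ S.η ^ (-T) ≤ S.φ S.η ^ (T - G) := S.zpow_le (by linarith)
  have hA : 0 < S.φ S.η ^ (-T) := zpow_pos hq _
  have hB : 0 < S.φ S.η ^ (T - G) := zpow_pos hq _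
  have hAB : S.φ S.η ^ (-T) * S.φ S.η ^ (T - G) * S.φ S.η ^ G = 1 := by
    rw [← zpow_add₀ hq.ne', ← zpow_add₀ hq.ne', show -T + (T - G) + G = 0 by ring, zpow_zero]
  have hcard' : (p.card : ℝ) + m.card + z.card ≤ k := by exact_mod_cast hcard
  have hp0 : (0 : ℝ) ≤ p.card := Nat.cast_nonneg _
  have hm0 : (0 : ℝ) ≤ m.card := Nat.cast_nonneg _
  have hz0 : (0 : ℝ) ≤ z.card := Nat.cast_nonneg _
  have hk0 : (0 : ℝ) ≤ k := Nat.cast_nonneg _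
  have hn1 := congrArg S.φ hn
  have hn2 := congrArg (fun x => S.φ (S.σ x)) hn
  simp only [map_add, map_intCast] at hn1 hn2
  by_contra hne
  have h1 := S.one_le_norm _ (sub_ne_zero.2 hne)
  rw [map_sub, map_sub, map_sub, S.σ_σ] at h1
  rw [show S.φ (unitSum p) - S.φ (S.σ (unitSum m)) = (S.φ (S.σ (unitSum p)) - S.φ (unitSum m)) +
    (S.φ (S.σ (unitSum z)) - S.φ (unitSum z)) by linarith] at h1
  have c1 : |S.φ (S.σ (unitSum p)) - S.φ (unitSum m)| ≤ k * S.φ S.η ^ (-T) := by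
    refine (abs_sub _ _).trans ?_
    nlinarith
  have c2 : |S.φ (S.σ (unitSum z)) - S.φ (unitSum z)| ≤ 2 * z.card * S.φ S.η ^ (T - G) := by
    refine (abs_sub _ _).trans ?_
    nlinarith
  have c3 : |S.φ (S.σ (unitSum p)) - S.φ (unitSum m)| ≤
      (p.card + m.card) * S.φ S.η ^ (T - G) := by
    refine (abs_sub _ _).trans ?_
    nlinarith
  have c4 : |(S.φ (S.σ (unitSum p)) - S.φ (unitSum m)) +
      (S.φ (S.σ (unitSum z)) - S.φ (unitSum z))| ≤ 2 * k * S.φ S.η ^ (T - G) := by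
    refine (abs_add_le _ _).trans ?_
    nlinarith
  have c5 := mul_le_mul c4 c1 (abs_nonneg _) (by positivity)
  have c6 : 2 * (k : ℝ) ^ 2 * (S.φ S.η ^ (-T) * S.φ S.η ^ (T - G)) ≤ 1 / 2 := by
    have := mul_le_mul_of_nonneg_right hkG (mul_pos hA hB).le
    linarith
  nlinarith

theorem zpow_le_of_unitSum_ne_zero (h0 : unitSum p ≠ 0) :
    S.φ S.η ^ T ≤ 2 * k * |(n : ℝ)| := by
  have hq := S.φ_η_pos
  have heq := S.upper_eq_conj_lower hG hkG hGT hcard hp hm hz hn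
  have bm := abs_map_unitSum_le S.φ m (S.φ S.η ^ (-T)) fun u hu => by
    rw [S.abs_unit]
    exact S.zpow_le (by linarith [hm u hu])
  have bz := abs_map_unitSum_le S.φ z (S.φ S.η ^ (T - G)) fun u hu => by
    rw [S.abs_unit]
    exact S.zpow_le ((le_abs_self _).trans (hz u hu))
  have hle : S.φ S.η ^ (-T) ≤ S.φ S.η ^ (T - G) := S.zpow_le (by linarith)
  have hA : 0 < S.φ S.η ^ (-T) := zpow_pos hq _
  have hB : 0 < S.φ S.η ^ (T - G) := zpow_pos hq _
  have hC : 0 < S.φ S.η ^ T := zpow_pos hq _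
  have hAC : S.φ S.η ^ (-T) * S.φ S.η ^ T = 1 := by
    rw [← zpow_add₀ hq.ne', neg_add_cancel, zpow_zero]
  have hBG : S.φ S.η ^ (T - G) * S.φ S.η ^ G = S.φ S.η ^ T := by
    rw [← zpow_add₀ hq.ne', sub_add_cancel]
  have hcard' : (p.card : ℝ) + m.card + z.card ≤ k := by exact_mod_cast hcard
  have hp0 : (0 : ℝ) ≤ p.card := Nat.cast_nonneg _
  have hm0 : (0 : ℝ) ≤ m.card := Nat.cast_nonneg _
  have hz0 : (0 : ℝ) ≤ z.card := Nat.cast_nonneg _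
  have hk0 : (0 : ℝ) ≤ k := Nat.cast_nonneg _
  have h1 := S.one_le_norm _ h0
  rw [heq, S.σ_σ, ← heq] at h1
  have hlow : S.φ S.η ^ T ≤ k * |S.φ (unitSum p)| := by
    have c1 : |S.φ (unitSum m)| ≤ k * S.φ S.η ^ (-T) := by nlinarith
    have c2 : 1 ≤ |S.φ (unitSum p)| * (k * S.φ S.η ^ (-T)) :=
      h1.trans (mul_le_mul_of_nonneg_left c1 (abs_nonneg _))
    have c3 := mul_le_mul_of_nonneg_right c2 hC.le
    calc S.φ S.η ^ T ≤ |S.φ (unitSum p)| * (k * S.φ S.η ^ (-T)) * S.φ S.η ^ T := by linarith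
      _ = k * |S.φ (unitSum p)| * (S.φ S.η ^ (-T) * S.φ S.η ^ T) := by ring
      _ = k * |S.φ (unitSum p)| := by rw [hAC, mul_one]
  have hn1 := congrArg S.φ hn
  simp only [map_add, map_intCast] at hn1
  have hup : |S.φ (unitSum p)| ≤ |(n : ℝ)| + k * S.φ S.η ^ (T - G) := by
    rw [show S.φ (unitSum p) = n - (S.φ (unitSum m) + S.φ (unitSum z)) by linarith]
    refine (abs_sub _ _).trans ?_
    have := abs_add_le (S.φ (unitSum m)) (S.φ (unitSum z))
    nlinarith
  have c4 := mul_le_mul_of_nonneg_left hup hk0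
  have c5 : 4 * (k * (k * S.φ S.η ^ (T - G))) ≤ S.φ S.η ^ T := by
    have := mul_le_mul_of_nonneg_right hkG hB.le
    nlinarith
  nlinarith [abs_nonneg (n : ℝ)]

end Cluster

/-- An integer of moderate size that is a sum of `k` units is so with bounded exponents. -/
theorem mem_unitSums_of_abs_lt {k : ℕ} {G M n : ℤ} (hG : 1 ≤ G)
    (hkG : 4 * (k : ℝ) ^ 2 ≤ S.φ S.η ^ G) (hM : (k + 1) * G + 1 ≤ M)
    (hn : 2 * k * |(n : ℝ)| < S.φ S.η ^ (M - k * G)) (s : Multiset Rˣ) (hs : s.card ≤ k)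
    (hsn : unitSum s = n) : n ∈ S.unitSums k M := by
  induction hc : s.card using Nat.strong_induction_on generalizing s with
  | _ c ih =>
    subst hc
    by_cases hall : ∀ u ∈ s, |S.ex u| ≤ M
    · exact ⟨s, hs, hall, hsn⟩
    push Not at hall
    obtain ⟨u, hu, huM⟩ := hall
    obtain ⟨p, m, z, T, rfl, hGT, hp, hm, hz, hlt, hle⟩ :=
      S.exists_gap k G hG s hs ⟨u, hu, by linarith⟩
    rw [unitSum_add, unitSum_add] at hsn
    rw [Multiset.card_add, Multiset.card_add] at hs
    have heq := S.upper_eq_conj_lower (by linarith) hkG hGT hs hp hm hz hsn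
    by_cases h0 : unitSum p = 0
    · have h0' : unitSum m = 0 := S.σ_injective (by rw [← heq, h0, map_zero])
      exact ih _ hlt z (by omega) (by rw [← hsn, h0, h0', zero_add, zero_add]) rfl
    · have h1 := S.zpow_le_of_unitSum_ne_zero (by linarith) hkG hGT hs hp hm hz hsn h0
      have h2 := S.zpow_le (a := M - k * G) (b := T) (by linarith [hle u hu])
      linarith

/-- The trace of the `a`-th power of the fundamental unit. -/
noncomputable def trPow (a : ℤ) : ℤ := S.tr ((S.η ^ a : Rˣ) : R)

theorem exists_add_conj_eq (u : Rˣ) :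
    ∃ ε : ℤˣ, (u : R) + S.σ u = ((ε * S.trPow (S.ex u) : ℤ) : R) := by
  rcases S.eq_or_eq_neg u with h | h
  · refine ⟨1, ?_⟩
    rw [S.add_conj]
    conv_lhs => rw [h]
    simp [trPow]
  · refine ⟨-1, ?_⟩
    conv_lhs => rw [h]
    rw [Units.val_neg, map_neg, ← neg_add, S.add_conj]
    simp [trPow]

/-- Splitting off the units of largest exponent. -/
theorem unitSums_cases {k : ℕ} {G M n : ℤ} (hG : 1 ≤ G)
    (hkG : 4 * ((k + 2 : ℕ) : ℝ) ^ 2 ≤ S.φ S.η ^ G) (hn : n ∈ S.unitSums (k + 2) M) :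
    n ∈ S.unitSums (k + 2) ((k + 3) * G + 1) ∨
    (∃ a : ℤ, 1 ≤ a ∧ a ≤ M ∧ ∃ ε : ℤˣ, ∃ n' ∈ S.unitSums k (a - 1), n = ε * S.trPow a + n') ∨
    (2 ≤ k ∧ ∃ T : ℤ, 0 ≤ T ∧ T ≤ M ∧
      ∃ x : R, (|S.φ x| ≤ (k + 2) * S.φ S.η ^ ((k + 2) * G + 1) ∧
        |S.φ (S.σ x)| ≤ (k + 2) * S.φ S.η ^ ((k + 2) * G + 1)) ∧
      ∃ n' ∈ S.unitSums (k - 2) M, n = S.tr (x * (S.η ^ T : Rˣ)) + n') := by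
  obtain ⟨s, hs, hsM, hsn⟩ := hn
  induction hc : s.card using Nat.strong_induction_on generalizing s with
  | _ c ih =>
    subst hc
    by_cases hall : ∀ u ∈ s, |S.ex u| ≤ (k + 3) * G + 1
    · exact Or.inl ⟨s, hs, hall, hsn⟩
    push Not at hall
    obtain ⟨u, hu, huM⟩ := hall
    obtain ⟨p, m, z, T, rfl, hGT, hp, hm, hz, hlt, hle⟩ :=
      S.exists_gap (k + 2) G hG s hs ⟨u, hu, by push_cast; linarith⟩
    rw [unitSum_add, unitSum_add] at hsn
    rw [Multiset.card_add, Multiset.card_add] at hs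
    have hpM : ∀ u ∈ p, S.ex u ≤ M := fun u hu =>
      (le_abs_self _).trans (hsM u (by simp [hu]))
    have hmM : ∀ u ∈ m, -S.ex u ≤ M := fun u hu =>
      (neg_le_abs _).trans (hsM u (by simp [hu]))
    have hzM : ∀ u ∈ z, |S.ex u| ≤ M := fun u hu => hsM u (by simp [hu])
    have heq := S.upper_eq_conj_lower (by linarith) hkG hGT hs hp hm hz hsn
    by_cases h0 : unitSum p = 0
    · have h0' : unitSum m = 0 := S.σ_injective (by rw [← heq, h0, map_zero])
      exact ih _ hlt z (by omega) hzM (by rw [← hsn, h0, h0', zero_add, zero_add]) rfl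
    right
    have hσp : unitSum m = S.σ (unitSum p) := by rw [heq, S.σ_σ]
    have h0' : unitSum m ≠ 0 := fun h => h0 (by rw [heq, h, map_zero])
    have hpc : 1 ≤ p.card := by
      rw [Nat.one_le_iff_ne_zero, Ne, Multiset.card_eq_zero]
      rintro rfl
      exact h0 rfl
    have hmc : 1 ≤ m.card := by
      rw [Nat.one_le_iff_ne_zero, Ne, Multiset.card_eq_zero]
      rintro rfl
      exact h0' rfl
    have hz_sum : unitSum z = ((n - S.tr (unitSum p) : ℤ) : R) := by
      rw [Int.cast_sub, ← hsn, ← S.add_conj, hσp]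
      ring
    have hunit (v : Rˣ) (a : ℤ) (ha : S.ex v = a) (haT : T < a) (haM : a ≤ M)
        (hv : unitSum p + unitSum m = v + S.σ v) : ∃ a : ℤ, 1 ≤ a ∧ a ≤ M ∧ ∃ ε : ℤˣ,
          ∃ n' ∈ S.unitSums k (a - 1), n = ε * S.trPow a + n' := by
      obtain ⟨ε, hε⟩ := S.exists_add_conj_eq v
      refine ⟨a, by linarith, haM, ε, n - ε * S.trPow a,
        ⟨z, by omega, fun u hu => by linarith [hz u hu], ?_⟩, by ring⟩
      rw [Int.cast_sub, ← ha, ← hε, ← hv, ← hsn]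
      ring
    by_cases hp1 : p.card = 1
    · obtain ⟨v, rfl⟩ := Multiset.card_eq_one.1 hp1
      refine Or.inl (hunit v _ rfl (hp v (by simp)) (hpM v (by simp)) ?_)
      rw [hσp, unitSum_singleton]
    by_cases hm1 : m.card = 1
    · obtain ⟨v, rfl⟩ := Multiset.card_eq_one.1 hm1
      refine Or.inl (hunit (Units.map S.σ v) (-S.ex v) ?_ ?_ (hmM v (by simp)) ?_)
      · exact S.ex_eq_of_abs_eq (S.abs_unit_conj v)
      · linarith [hm v (by simp)]
      · simp [heq, S.σ_σ]
    refine Or.inr ⟨by omega, T, by linarith, ?_, unitSum p * (S.η ^ (-T) : Rˣ), ⟨?_, ?_⟩,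
      n - S.tr (unitSum p), ⟨z, by omega, hzM, hz_sum⟩, ?_⟩
    · obtain ⟨v, hv⟩ := Multiset.card_pos_iff_exists_mem.1 hpc
      exact (hp v hv).le.trans (hpM v hv)
    · have b := abs_map_unitSum_le S.φ p (S.φ S.η ^ (T + (k + 2) * G + 1)) fun u hu => by
        rw [S.abs_unit]
        refine S.zpow_le ((le_abs_self _).trans ?_)
        have := hle u (by simp [hu])
        push_cast at this
        exact this
      have hpk : (p.card : ℝ) ≤ k + 2 := by
        have : p.card ≤ k + 2 := by omega
        exact_mod_cast this
      have h1 : 0 < S.φ S.η ^ (-T) := zpow_pos S.φ_η_pos _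
      rw [map_mul, map_units_zpow, abs_mul, abs_of_pos h1]
      calc _ ≤ p.card * S.φ S.η ^ (T + (k + 2) * G + 1) * S.φ S.η ^ (-T) :=
            mul_le_mul_of_nonneg_right b h1.le
        _ = p.card * S.φ S.η ^ ((k + 2) * G + 1) := by
            rw [mul_assoc, ← zpow_add₀ S.φ_η_pos.ne']
            congr 2
            ring
        _ ≤ _ := mul_le_mul_of_nonneg_right hpk (zpow_pos S.φ_η_pos _).le
    · have b := abs_map_unitSum_le S.φ m (S.φ S.η ^ (-T)) fun u hu => by
        rw [S.abs_unit]
        exact S.zpow_le (by linarith [hm u hu])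
      have hmk : (m.card : ℝ) ≤ k + 2 := by
        have : m.card ≤ k + 2 := by omega
        exact_mod_cast this
      have h1 : 0 < S.φ S.η ^ T := zpow_pos S.φ_η_pos _
      have h2 : |S.φ (S.σ (S.η ^ (-T) : Rˣ))| = S.φ S.η ^ T := by
        rw [S.abs_unit_conj, S.ex_eq_of_abs_eq (a := -T), neg_neg]
        rw [map_units_zpow]
        exact abs_of_pos (zpow_pos S.φ_η_pos _)
      rw [map_mul, ← hσp, map_mul, abs_mul, h2]
      calc _ ≤ m.card * S.φ S.η ^ (-T) * S.φ S.η ^ T := mul_le_mul_of_nonneg_right b h1.le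
        _ = m.card * S.φ S.η ^ (0 : ℤ) := by
            rw [mul_assoc, ← zpow_add₀ S.φ_η_pos.ne', neg_add_cancel]
        _ ≤ _ := mul_le_mul hmk (S.zpow_le (by positivity)) (zpow_pos S.φ_η_pos _).le
            (by positivity)
    · rw [mul_assoc, ← Units.val_mul, ← zpow_add, neg_add_cancel, zpow_zero, Units.val_one, mul_one]
      ring

theorem ex_η_zpow (a : ℤ) : S.ex (S.η ^ a) = a := by
  apply S.ex_eq_of_abs_eq
  rw [map_units_zpow, abs_of_pos (zpow_pos S.φ_η_pos _)]

theorem ex_neg (u : Rˣ) : S.ex (-u) = S.ex u := by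
  apply S.ex_eq_of_abs_eq
  rw [Units.val_neg, map_neg, abs_neg, S.abs_unit]

theorem ex_conj (u : Rˣ) : S.ex (Units.map S.σ u) = -S.ex u :=
  S.ex_eq_of_abs_eq (S.abs_unit_conj u)

theorem add_mem_unitSums {k : ℕ} {a b M n : ℤ} (hb : b ≤ M) (ha : |a| ≤ M) (ε : ℤˣ)
    (hn : n ∈ S.unitSums k b) : ε * S.trPow a + n ∈ S.unitSums (k + 2) M := by
  obtain ⟨s, h1, h2, h3⟩ := hn
  obtain ⟨v, hv, hv'⟩ : ∃ v : Rˣ, S.ex v = a ∧ (v : R) + S.σ v = ((ε * S.trPow a : ℤ) : R) := by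
    have h := S.add_conj ((S.η ^ a : Rˣ) : R)
    rcases Int.units_eq_one_or ε with rfl | rfl
    · exact ⟨S.η ^ a, S.ex_η_zpow a, by rw [h]; simp [trPow]⟩
    · refine ⟨-S.η ^ a, by rw [S.ex_neg, S.ex_η_zpow], ?_⟩
      rw [Units.val_neg, map_neg, ← neg_add, h]
      simp [trPow]
  refine ⟨v ::ₘ Units.map S.σ v ::ₘ s, by simpa using h1, fun u hu => ?_, ?_⟩
  · rw [Multiset.mem_cons, Multiset.mem_cons] at hu
    rcases hu with rfl | rfl | hu
    · rwa [hv]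
    · rwa [S.ex_conj, abs_neg, hv]
    · exact (h2 u hu).trans hb
  · rw [unitSum_cons, unitSum_cons, h3, ← add_assoc, Units.coe_map, Int.cast_add, ← hv']
    rfl

theorem abs_trPow_sub_le {a : ℤ} (ha : 0 ≤ a) : |(S.trPow a : ℝ) - S.φ S.η ^ a| ≤ 1 := by
  rw [trPow, ← S.φ_add_conj, map_units_zpow, add_sub_cancel_left, S.abs_unit_conj, S.ex_η_zpow]
  exact (S.zpow_le (neg_nonpos.2 ha)).trans_eq (zpow_zero _)

/-- For a sufficiently large gap, the sum of a signed trace and of an integer in `unitSums k`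
determines both. -/
theorem exists_gap_unique (k : ℕ) : ∃ G : ℕ, ∀ (a b : ℤ) (ε δ : ℤˣ) (n m : ℤ),
    G ≤ a → G ≤ b → n ∈ S.unitSums k (a - G) → m ∈ S.unitSums k (b - G) →
    ε * S.trPow a + n = δ * S.trPow b + m → a = b ∧ ε = δ ∧ n = m := by
  have hq := S.φ_η_pos
  have hq1 := S.one_lt
  obtain ⟨G, hG⟩ := pow_unbounded_of_one_lt
    ((k + 1) * ((S.φ S.η + 1) / (S.φ S.η - 1))) hq1
  rw [← mul_div_assoc, div_lt_iff₀ (by linarith)] at hG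
  have key (a : ℤ) (ε : ℤˣ) (n : ℤ) (ha : G ≤ a) (hn : n ∈ S.unitSums k (a - G)) :
      |(ε : ℝ) * (ε * S.trPow a + n) - S.φ S.η ^ a| ≤ (k + 1) * S.φ S.η ^ (a - G) := by
    have h1 := S.abs_trPow_sub_le (a := a) (by linarith [Int.natCast_nonneg G])
    have h2 := S.abs_le_of_mem_unitSums hn
    have h3 : 1 ≤ S.φ S.η ^ (a - G) := (zpow_zero _).symm.trans_le (S.zpow_le (by linarith))
    have hε2 : (ε : ℝ) * ε = 1 := by
      rcases Int.units_eq_one_or ε with rfl | rfl <;> simp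
    have hε1 : |(ε : ℝ)| = 1 := by
      rcases Int.units_eq_one_or ε with rfl | rfl <;> simp
    rw [show (ε : ℝ) * (ε * S.trPow a + n) - S.φ S.η ^ a =
      (S.trPow a - S.φ S.η ^ a) + ε * n by linear_combination S.trPow a * hε2]
    refine (abs_add_le _ _).trans ?_
    rw [abs_mul, hε1]
    linarith
  have hsmall (a : ℤ) : (k + 1) * S.φ S.η ^ (a - G) * (S.φ S.η + 1) <
      S.φ S.η ^ a * (S.φ S.η - 1) := by
    have h1 := mul_lt_mul_of_pos_right hG (zpow_pos hq (a - G))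
    have h2 : S.φ S.η ^ G * S.φ S.η ^ (a - G) = S.φ S.η ^ a := by
      rw [← zpow_natCast, ← zpow_add₀ hq.ne', add_sub_cancel]
    calc _ = (k + 1) * (S.φ S.η + 1) * S.φ S.η ^ (a - G) := by ring
      _ < _ := h1
      _ = _ := by rw [← h2]; ring
  have hpos (a : ℤ) : (k + 1) * S.φ S.η ^ (a - G) < S.φ S.η ^ a := by
    have h1 := hsmall a
    have h2 : 0 < (k + 1) * S.φ S.η ^ (a - G) := by positivity
    have h3 : 0 < S.φ S.η ^ a := by positivity
    nlinarith
  have hnot (a b : ℤ) (N : ℝ) (h1 : |N - S.φ S.η ^ a| ≤ (k + 1) * S.φ S.η ^ (a - G))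
      (h2 : |N - S.φ S.η ^ b| ≤ (k + 1) * S.φ S.η ^ (b - G)) : ¬ a < b := by
    intro hab
    have h3 := S.zpow_le (a := a) (b := b - 1) (by linarith)
    have h3' := S.zpow_le (a := a - G) (b := b - 1 - G) (by linarith)
    have e1 : S.φ S.η ^ (b - 1) * S.φ S.η = S.φ S.η ^ b := by
      rw [← zpow_add_one₀ hq.ne', sub_add_cancel]
    have e2 : S.φ S.η ^ (b - 1 - G) * S.φ S.η = S.φ S.η ^ (b - G) := by
      rw [← zpow_add_one₀ hq.ne']
      congr 1
      ring
    have h4 := hsmall (b - 1)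
    have h5 := (abs_le.1 h1).2
    have h6 := (abs_le.1 h2).1
    have h7 := mul_le_mul_of_nonneg_left h3' (by positivity : (0 : ℝ) ≤ k + 1)
    rw [← e1, ← e2] at h6
    linarith
  refine ⟨G, fun a b ε δ n m ha hb hn hm h => ?_⟩
  have h1 := key a ε n ha hn
  have h2 := key b δ m hb hm
  have hR : (ε * S.trPow a + n : ℝ) = δ * S.trPow b + m := by exact_mod_cast h
  rw [← hR] at h2
  have hεδ : ε = δ := by
    have p1 := (abs_le.1 h1).1
    have p2 := (abs_le.1 h2).1
    have q1 := hpos a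
    have q2 := hpos b
    rcases Int.units_eq_one_or ε with rfl | rfl <;> rcases Int.units_eq_one_or δ with rfl | rfl
    · rfl
    · push_cast at p1 p2
      linarith
    · push_cast at p1 p2
      linarith
    · rfl
  subst hεδ
  have hab : a = b := le_antisymm (not_lt.1 (hnot b a _ h2 h1)) (not_lt.1 (hnot a b _ h1 h2))
  subst hab
  exact ⟨rfl, rfl, by linarith⟩

theorem ncard_unitSums_zero (M : ℤ) : (S.unitSums 0 M).ncard = 1 := by
  rw [Set.ncard_eq_one]
  refine ⟨0, Set.ext fun n => ⟨?_, ?_⟩⟩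
  · rintro ⟨s, h1, -, h3⟩
    obtain rfl := Multiset.card_eq_zero.1 (Nat.le_zero.1 h1)
    rw [unitSum_zero] at h3
    exact S.intCast_injective (by rw [← h3, Int.cast_zero])
  · rintro rfl
    exact ⟨0, by simp, by simp, by simp⟩

include S in
theorem eq_of_unitSum_card_le_one {n : ℤ} {s : Multiset Rˣ} (hs : s.card ≤ 1)
    (hn : unitSum s = n) : n = -1 ∨ n = 0 ∨ n = 1 := by
  rcases Nat.le_one_iff_eq_zero_or_eq_one.1 hs with h | h
  · obtain rfl := Multiset.card_eq_zero.1 h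
    rw [unitSum_zero] at hn
    exact Or.inr (Or.inl (S.intCast_injective (by rw [← hn, Int.cast_zero])))
  · obtain ⟨u, rfl⟩ := Multiset.card_eq_one.1 h
    rw [unitSum_singleton] at hn
    have h1 := S.abs_unit_mul_conj u
    rw [hn, map_intCast, map_intCast, map_intCast, ← Int.cast_abs] at h1
    have h2 : |n| * |n| = 1 := by exact_mod_cast h1
    have h3 : n * n = 1 := by rwa [abs_mul_abs_self] at h2
    rcases mul_self_eq_one_iff.1 h3 with h | h
    · exact Or.inr (Or.inr h)
    · exact Or.inl h

theorem exists_unitSum_card_le_one {n : ℤ} (hn : n = -1 ∨ n = 0 ∨ n = 1) :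
    ∃ s : Multiset Rˣ, s.card ≤ 1 ∧ (∀ u ∈ s, S.ex u = 0) ∧ unitSum s = n := by
  have h1 : S.ex 1 = 0 := by simpa using S.ex_η_zpow 0
  rcases hn with rfl | rfl | rfl
  · exact ⟨{-1}, by simp, by simp [S.ex_neg, h1], by simp⟩
  · exact ⟨0, by simp, by simp, by simp⟩
  · exact ⟨{1}, by simp, by simp [h1], by simp⟩

theorem ncard_unitSums_one {M : ℤ} (hM : 0 ≤ M) : (S.unitSums 1 M).ncard = 3 := by
  have : S.unitSums 1 M = {-1, 0, 1} := by
    ext n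
    constructor
    · rintro ⟨s, h1, -, h3⟩
      simpa using S.eq_of_unitSum_card_le_one h1 h3
    · intro h
      obtain ⟨s, h1, h2, h3⟩ := S.exists_unitSum_card_le_one (by simpa using h)
      exact ⟨s, h1, fun u hu => by rwa [h2 u hu, abs_zero], h3⟩
  rw [this, Set.ncard_eq_three]
  exact ⟨-1, 0, 1, by norm_num, by norm_num, by norm_num, rfl⟩

/-- A gap length for which clusters of at most `k` units separate. -/
theorem exists_gap_length (k : ℕ) : ∃ G : ℤ, 1 ≤ G ∧ 4 * (k : ℝ) ^ 2 ≤ S.φ S.η ^ G := by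
  obtain ⟨G, hG⟩ := pow_unbounded_of_one_lt (4 * (k : ℝ) ^ 2) S.one_lt
  refine ⟨G + 1, by linarith [Int.natCast_nonneg G], ?_⟩
  refine (hG.le.trans_eq (zpow_natCast _ _).symm).trans (S.zpow_le (by linarith))

theorem ncard_unitSums_le (k : ℕ) : ∃ C : ℕ, ∀ M : ℕ,
    (S.unitSums (k + 2) M).ncard ≤ C + 2 * ∑ b ∈ Finset.range M, (S.unitSums k b).ncard +
      if 2 ≤ k then C * (M + 1) * (S.unitSums (k - 2) M).ncard else 0 := by
  classical
  obtain ⟨G, hG, hkG⟩ := S.exists_gap_length (k + 2)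
  set B := (k + 2) * S.φ S.η ^ ((k + 2) * G + 1)
  have hfin := S.finite_bounded_conjugates B
  let U (j : ℕ) (M : ℤ) : Finset ℤ := (S.finite_unitSums j M).toFinset
  have hU (j : ℕ) (M : ℤ) : (U j M).card = (S.unitSums j M).ncard :=
    (Set.ncard_eq_toFinset_card _ _).symm
  let P (M : ℕ) : Finset ℤ := ((Finset.range M).sigma fun b =>
    (Finset.univ : Finset ℤˣ) ×ˢ U k b).image
      fun x => (x.2.1 : ℤ) * S.trPow (x.1 + 1) + x.2.2
  let Q (M : ℕ) : Finset ℤ := if 2 ≤ k then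
    (Finset.range (M + 1) ×ˢ hfin.toFinset ×ˢ U (k - 2) M).image
      fun x => S.tr (x.2.1 * (S.η ^ (x.1 : ℤ) : Rˣ)) + x.2.2 else ∅
  have hP (M : ℕ) : (P M).card ≤ 2 * ∑ b ∈ Finset.range M, (S.unitSums k b).ncard := by
    refine Finset.card_image_le.trans_eq ?_
    rw [Finset.card_sigma, Finset.mul_sum]
    refine Finset.sum_congr rfl fun b _ => ?_
    rw [Finset.card_product, hU]
    rfl
  have hQ (M : ℕ) : (Q M).card ≤
      if 2 ≤ k then hfin.toFinset.card * (M + 1) * (S.unitSums (k - 2) M).ncard else 0 := by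
    by_cases hk : 2 ≤ k
    · simp only [Q, if_pos hk]
      refine Finset.card_image_le.trans_eq ?_
      rw [Finset.card_product, Finset.card_product, hU, Finset.card_range]
      ring
    · simp [Q, hk]
  refine ⟨(S.unitSums (k + 2) ((k + 3) * G + 1)).ncard + hfin.toFinset.card, fun M => ?_⟩
  have hsub : S.unitSums (k + 2) M ⊆ ↑(U (k + 2) ((k + 3) * G + 1) ∪ P M ∪ Q M) := by
    intro n hn
    rw [Finset.mem_coe, Finset.mem_union, Finset.mem_union]
    rcases S.unitSums_cases hG hkG hn with h | ⟨a, h1, h2, ε, n', h3, rfl⟩ |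
      ⟨hk, T, h1, h2, x, hx, n', h3, rfl⟩
    · exact Or.inl (Or.inl (by simpa [U] using h))
    · refine Or.inl (Or.inr (Finset.mem_image.2 ⟨⟨(a - 1).toNat, ε, n'⟩, ?_, ?_⟩))
      · have : (((a - 1).toNat : ℕ) : ℤ) = a - 1 := Int.toNat_of_nonneg (by linarith)
        simp only [Finset.mem_sigma, Finset.mem_range, Finset.mem_product, Finset.mem_univ,
          true_and, U, Set.Finite.mem_toFinset, this]
        exact ⟨by omega, h3⟩
      · simp only
        rw [Int.toNat_of_nonneg (by linarith), sub_add_cancel]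
    · refine Or.inr ?_
      simp only [Q, if_pos hk]
      refine Finset.mem_image.2 ⟨(T.toNat, x, n'), ?_, ?_⟩
      · simp only [Finset.mem_range, Finset.mem_product, U, Set.Finite.mem_toFinset]
        exact ⟨by omega, hx, h3⟩
      · simp only
        rw [Int.toNat_of_nonneg h1]
  have h1 := Set.ncard_le_ncard hsub (Finset.finite_toSet _)
  rw [Set.ncard_coe_finset] at h1
  have h2 := Finset.card_union_le (U (k + 2) ((k + 3) * G + 1) ∪ P M) (Q M)
  have h3 := Finset.card_union_le (U (k + 2) ((k + 3) * G + 1)) (P M)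
  rw [hU] at h3
  have h4 := hP M
  have h5 := hQ M
  split_ifs at h5 ⊢ with hk
  · have h6 : hfin.toFinset.card * (M + 1) * (S.unitSums (k - 2) M).ncard ≤
      ((S.unitSums (k + 2) ((k + 3) * G + 1)).ncard + hfin.toFinset.card) * (M + 1) *
        (S.unitSums (k - 2) M).ncard := by
      gcongr
      exact Nat.le_add_left _ _
    omega
  · omega

theorem le_ncard_unitSums (k : ℕ) : ∃ G : ℕ, ∀ M : ℕ,
    2 * ∑ b ∈ Finset.range (M - G), (S.unitSums k b).ncard ≤ (S.unitSums (k + 2) M).ncard := by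
  obtain ⟨G, hG⟩ := S.exists_gap_unique k
  let U (j : ℕ) (M : ℤ) : Finset ℤ := (S.finite_unitSums j M).toFinset
  have hU (j : ℕ) (M : ℤ) : (U j M).card = (S.unitSums j M).ncard :=
    (Set.ncard_eq_toFinset_card _ _).symm
  refine ⟨G, fun M => ?_⟩
  have hcard : 2 * ∑ b ∈ Finset.range (M - G), (S.unitSums k b).ncard =
      ((Finset.range (M - G)).sigma fun b => (Finset.univ : Finset ℤˣ) ×ˢ U k b).card := by
    rw [Finset.card_sigma, Finset.mul_sum]
    refine Finset.sum_congr rfl fun b _ => ?_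
    rw [Finset.card_product, hU]
    rfl
  rw [hcard, ← hU]
  refine Finset.card_le_card_of_injOn
    (fun x => (x.2.1 : ℤ) * S.trPow ((x.1 : ℤ) + G) + x.2.2) ?_ ?_
  · rintro ⟨b, ε, n⟩ hx
    simp only [Finset.coe_sigma, Set.mem_sigma_iff, Finset.mem_coe, Finset.mem_range,
      Finset.mem_product, Finset.mem_univ, true_and, U, Set.Finite.mem_toFinset] at hx ⊢
    refine S.add_mem_unitSums (b := b) (by omega) ?_ ε hx.2
    rw [abs_of_nonneg (by positivity)]
    omega
  · rintro ⟨b, ε, n⟩ hx ⟨b', ε', n'⟩ hx' h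
    simp only [Finset.coe_sigma, Set.mem_sigma_iff, Finset.mem_coe, Finset.mem_range,
      Finset.mem_product, Finset.mem_univ, true_and, U, Set.Finite.mem_toFinset] at hx hx'
    obtain ⟨h1, rfl, rfl⟩ := hG (b + G) (b' + G) ε ε' n n' (by linarith [Int.natCast_nonneg b])
      (by linarith [Int.natCast_nonneg b']) (by rw [add_sub_cancel_right]; exact hx.2)
      (by rw [add_sub_cancel_right]; exact hx'.2) h
    have : b = b' := by omega
    subst this
    rfl

end RealQuadraticUnits

theorem pow_succ_add_le_succ_pow (n : ℕ) {x : ℝ} (hx : 0 ≤ x) :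
    x ^ (n + 1) + (n + 1) * x ^ n ≤ (x + 1) ^ (n + 1) := by
  induction n with
  | zero => simp
  | succ n ih =>
    have h := mul_le_mul_of_nonneg_right ih (by linarith : 0 ≤ x + 1)
    have h1 : 0 ≤ ((n : ℝ) + 1) * x ^ n := by positivity
    push_cast
    simp only [pow_succ] at h h1 ⊢
    linarith

theorem succ_pow_le_pow_succ_add (n : ℕ) {x : ℝ} (hx : 0 ≤ x) :
    (x + 1) ^ (n + 1) ≤ x ^ (n + 1) + (n + 1) * (x + 1) ^ n := by
  induction n with
  | zero => simp
  | succ n ih =>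
    have h := mul_le_mul_of_nonneg_right ih hx
    have h1 : 0 ≤ ((n : ℝ) + 1) * (x + 1) ^ n := by positivity
    push_cast
    simp only [pow_succ] at h h1 ⊢
    linarith

theorem mul_sum_range_pow_le (ρ M : ℕ) :
    ((ρ : ℝ) + 1) * ∑ b ∈ Finset.range M, (b : ℝ) ^ ρ ≤ (M : ℝ) ^ (ρ + 1) := by
  induction M with
  | zero => simp
  | succ M ih =>
    rw [Finset.sum_range_succ, mul_add]
    push_cast
    linarith [pow_succ_add_le_succ_pow ρ (Nat.cast_nonneg (α := ℝ) M)]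

theorem pow_succ_le_mul_sum_range_pow (ρ M : ℕ) :
    (M : ℝ) ^ (ρ + 1) ≤ ((ρ : ℝ) + 1) * (∑ b ∈ Finset.range M, (b : ℝ) ^ ρ + (M : ℝ) ^ ρ) := by
  induction M with
  | zero => simp; positivity
  | succ M ih =>
    rw [Finset.sum_range_succ]
    push_cast
    linarith [succ_pow_le_pow_succ_add ρ (Nat.cast_nonneg (α := ℝ) M)]

/-- Summation of an asymptotic expansion with leading term `A * M ^ ρ`. -/
theorem exists_asymptotic_of_sum_bounds {g h : ℕ → ℝ} {A C D : ℝ} {ρ G : ℕ} (hA : 0 ≤ A)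
    (hC : 0 ≤ C) (hD : 0 ≤ D) (hg : ∀ b : ℕ, |g b - A * b ^ ρ| ≤ C * ρ * ((b : ℝ) + 1) ^ (ρ - 1))
    (hup : ∀ M : ℕ, h M ≤ 2 * ∑ b ∈ Finset.range M, g b + D * ((M : ℝ) + 1) ^ ρ)
    (hlow : ∀ M : ℕ, 2 * ∑ b ∈ Finset.range (M - G), g b ≤ h M) :
    ∃ E : ℝ, 0 ≤ E ∧ ∀ M : ℕ, |h M - 2 * A / (ρ + 1) * M ^ (ρ + 1)| ≤
      E * ((M : ℝ) + 1) ^ ρ := by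
  have hC' : 0 ≤ C * ρ := by positivity
  have hpow (M : ℕ) : ρ * ((M : ℝ) + 1) ^ (ρ - 1) * (M + 1) = ρ * ((M : ℝ) + 1) ^ ρ := by
    rcases Nat.eq_zero_or_pos ρ with rfl | hρ
    · simp
    · rw [mul_assoc, ← pow_succ, Nat.sub_add_cancel hρ]
  have hterm (M b : ℕ) (hb : b ∈ Finset.range M) :
      |g b - A * b ^ ρ| ≤ C * ρ * ((M : ℝ) + 1) ^ (ρ - 1) := by
    refine (hg b).trans ?_
    have : (b : ℝ) ≤ M := by exact_mod_cast (Finset.mem_range.1 hb).le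
    gcongr
  have hsum (M : ℕ) : |∑ b ∈ Finset.range M, g b - A * ∑ b ∈ Finset.range M, (b : ℝ) ^ ρ| ≤
      C * ρ * ((M : ℝ) + 1) ^ ρ := by
    rw [Finset.mul_sum, ← Finset.sum_sub_distrib]
    refine (Finset.abs_sum_le_sum_abs _ _).trans ((Finset.sum_le_sum (hterm M)).trans ?_)
    rw [Finset.sum_const, Finset.card_range, nsmul_eq_mul]
    have h1 : 0 ≤ C * ρ * ((M : ℝ) + 1) ^ (ρ - 1) := by positivity
    linear_combination h1 + C * hpow M
  have htail (M : ℕ) : ∑ b ∈ Finset.range M, g b ≤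
      ∑ b ∈ Finset.range (M - G), g b + G * ((A + C * ρ) * ((M : ℝ) + 1) ^ ρ) := by
    rw [← Finset.sum_range_add_sum_Ico g (Nat.sub_le M G)]
    gcongr
    have hb (b : ℕ) (hb : b ∈ Finset.Ico (M - G) M) :
        g b ≤ (A + C * ρ) * ((M : ℝ) + 1) ^ ρ := by
      have hbM : b < M := (Finset.mem_Ico.1 hb).2
      have h1 := (abs_le.1 (hterm M b (Finset.mem_range.2 hbM))).2
      have h2 : (b : ℝ) ^ ρ ≤ ((M : ℝ) + 1) ^ ρ := by
        have : (b : ℝ) ≤ M := by exact_mod_cast hbM.le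
        exact pow_le_pow_left₀ (Nat.cast_nonneg _) (by linarith) _
      have h3 := mul_le_mul_of_nonneg_left h2 hA
      have h4 : C * ρ * ((M : ℝ) + 1) ^ (ρ - 1) ≤ C * ρ * ((M : ℝ) + 1) ^ ρ := by
        have : (1 : ℝ) ≤ M + 1 := by linarith [Nat.cast_nonneg (α := ℝ) M]
        exact mul_le_mul_of_nonneg_left (pow_le_pow_right₀ this (Nat.sub_le _ _)) hC'
      linarith
    refine (Finset.sum_le_sum hb).trans ?_
    rw [Finset.sum_const, nsmul_eq_mul, Nat.card_Ico]
    have : ((M - (M - G) : ℕ) : ℝ) ≤ G := by exact_mod_cast (by omega : M - (M - G) ≤ G)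
    gcongr
  refine ⟨2 * A + 2 * (C * ρ) + D + 2 * (G * (A + C * ρ)), by positivity, fun M => ?_⟩
  have hM0 : (0 : ℝ) ≤ M := Nat.cast_nonneg _
  have hX : (0 : ℝ) ≤ ((M : ℝ) + 1) ^ ρ := by positivity
  have hMX : (M : ℝ) ^ ρ ≤ ((M : ℝ) + 1) ^ ρ := pow_le_pow_left₀ hM0 (by linarith) _
  set sg := ∑ b ∈ Finset.range M, g b
  set sp := ∑ b ∈ Finset.range M, (b : ℝ) ^ ρ
  have hρ : (0 : ℝ) < ρ + 1 := by positivity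
  have e1 : sp ≤ M ^ (ρ + 1) / (ρ + 1) := by
    rw [le_div_iff₀ hρ, mul_comm]
    exact mul_sum_range_pow_le ρ M
  have e2 : M ^ (ρ + 1) / (ρ + 1) ≤ sp + M ^ ρ := by
    rw [div_le_iff₀ hρ, mul_comm]
    exact pow_succ_le_mul_sum_range_pow ρ M
  have f1 := mul_le_mul_of_nonneg_left e1 hA
  have f2 := mul_le_mul_of_nonneg_left (e2.trans (add_le_add_right hMX _)) hA
  obtain ⟨f3, f4⟩ := abs_le.1 (hsum M)
  have f5 := hup M
  have f6 := hlow M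
  have f7 := htail M
  have f8 : 0 ≤ A * ((M : ℝ) + 1) ^ ρ := by positivity
  have f9 : 0 ≤ D * ((M : ℝ) + 1) ^ ρ := by positivity
  have f10 : 0 ≤ G * ((A + C * ρ) * ((M : ℝ) + 1) ^ ρ) := by positivity
  have f11 : 2 * A / (ρ + 1) * M ^ (ρ + 1) = 2 * (A * (M ^ (ρ + 1) / (ρ + 1))) := by ring
  rw [f11, abs_le]
  constructor <;> linarith

/-- Two-sided bounds at nearby integers give an asymptotic at a real argument. -/
theorem abs_sub_mul_pow_le {N B C D y : ℝ} {M₁ M₂ r : ℕ} (hB : 0 ≤ B) (hC : 0 ≤ C)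
    (hy : 0 ≤ y) (h₁ : |(M₁ : ℝ) - y| ≤ D) (h₂ : |(M₂ : ℝ) - y| ≤ D)
    (hlow : B * (M₁ : ℝ) ^ (r + 1) - C * ((M₁ : ℝ) + 1) ^ r ≤ N)
    (hup : N ≤ B * (M₂ : ℝ) ^ (r + 1) + C * ((M₂ : ℝ) + 1) ^ r) :
    |N - B * y ^ (r + 1)| ≤ (B * (D * (r + 1)) + C) * (y + D + 1) ^ r := by
  have key (M : ℕ) (h : |(M : ℝ) - y| ≤ D) :
      |B * (M : ℝ) ^ (r + 1) - B * y ^ (r + 1)| ≤ B * (D * (r + 1)) * (y + D + 1) ^ r ∧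
        C * ((M : ℝ) + 1) ^ r ≤ C * (y + D + 1) ^ r := by
    have hM : (0 : ℝ) ≤ M := Nat.cast_nonneg _
    have hMy := (abs_le.1 h).2
    have hD : 0 ≤ D := (abs_nonneg _).trans h
    constructor
    · rw [← mul_sub, abs_mul, abs_of_nonneg hB, mul_assoc]
      refine mul_le_mul_of_nonneg_left ?_ hB
      have h3 := abs_pow_sub_pow_le (M : ℝ) y (r + 1)
      refine h3.trans ?_
      rw [Nat.add_sub_cancel, abs_of_nonneg hM, abs_of_nonneg hy]
      have h4 : max (M : ℝ) y ≤ y + D + 1 := max_le (by linarith) (by linarith)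
      have h5 : 0 ≤ max (M : ℝ) y := le_max_of_le_right hy
      push_cast
      gcongr
    · gcongr
      linarith
  obtain ⟨a1, a2⟩ := key M₁ h₁
  obtain ⟨b1, b2⟩ := key M₂ h₂
  rw [abs_le] at a1 b1 ⊢
  constructor <;> linarith [a1.1, a1.2, b1.1, b1.2]

namespace RealQuadraticUnits

variable {R : Type*} [CommRing R] (S : RealQuadraticUnits R)

theorem ncard_unitSums_asymptotic (ρ e : ℕ) (he : e ≤ 1) : ∃ C : ℝ, 0 ≤ C ∧ ∀ M : ℕ,
    |((S.unitSums (2 * ρ + e) M).ncard : ℝ) -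
      (if e = 0 then 1 else 3) / (ρ.factorial : ℝ) * 2 ^ ρ * M ^ ρ| ≤
        C * ρ * ((M : ℝ) + 1) ^ (ρ - 1) := by
  set c : ℝ := if e = 0 then 1 else 3 with hc
  have hc0 : 0 ≤ c := by rw [hc]; split_ifs <;> norm_num
  suffices H : (∃ C : ℝ, 0 ≤ C ∧ ∀ M : ℕ, |((S.unitSums (2 * ρ + e) M).ncard : ℝ) -
      c / (ρ.factorial : ℝ) * 2 ^ ρ * M ^ ρ| ≤ C * ρ * ((M : ℝ) + 1) ^ (ρ - 1)) ∧
      (1 ≤ ρ → ∃ C : ℝ, 0 ≤ C ∧ ∀ M : ℕ, ((S.unitSums (2 * (ρ - 1) + e) M).ncard : ℝ) ≤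
        C * ((M : ℝ) + 1) ^ (ρ - 1)) from H.1
  induction ρ with
  | zero =>
    refine ⟨⟨0, le_rfl, fun M => ?_⟩, by simp⟩
    rcases Nat.le_one_iff_eq_zero_or_eq_one.1 he with rfl | rfl
    · simp [hc, S.ncard_unitSums_zero]
    · simp [hc, S.ncard_unitSums_one]
  | succ ρ ih =>
    obtain ⟨⟨C, hC, hmain⟩, hprev⟩ := ih
    set A : ℝ := c / (ρ.factorial : ℝ) * 2 ^ ρ with hA
    have hA0 : 0 ≤ A := by positivity
    constructor
    · obtain ⟨C₁, hup⟩ := S.ncard_unitSums_le (2 * ρ + e)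
      obtain ⟨G, hlow⟩ := S.le_ncard_unitSums (2 * ρ + e)
      obtain ⟨D, hD, hupD⟩ : ∃ D : ℝ, 0 ≤ D ∧ ∀ M : ℕ,
          ((S.unitSums (2 * ρ + e + 2) M).ncard : ℝ) ≤
            2 * ∑ b ∈ Finset.range M, ((S.unitSums (2 * ρ + e) b).ncard : ℝ) +
              D * ((M : ℝ) + 1) ^ ρ := by
        have hone (M : ℕ) : (1 : ℝ) ≤ ((M : ℝ) + 1) ^ ρ :=
          one_le_pow₀ (by linarith [Nat.cast_nonneg (α := ℝ) M])
        have hC₁ : (0 : ℝ) ≤ C₁ := Nat.cast_nonneg _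
        rcases Nat.eq_zero_or_pos ρ with rfl | hρ
        · refine ⟨C₁, hC₁, fun M => ?_⟩
          have h := hup M
          rw [if_neg (by omega), add_zero] at h
          have h' : ((S.unitSums (2 * 0 + e + 2) M).ncard : ℝ) ≤ C₁ + 2 *
              ∑ b ∈ Finset.range M, ((S.unitSums (2 * 0 + e) b).ncard : ℝ) := by
            exact_mod_cast h
          simp only [pow_zero]
          linarith
        · obtain ⟨C₂, hC₂, hbd⟩ := hprev hρ
          refine ⟨C₁ + C₁ * C₂, by positivity, fun M => ?_⟩
          have h := hup M
          rw [if_pos (by omega), show 2 * ρ + e - 2 = 2 * (ρ - 1) + e by omega] at h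
          have h' : ((S.unitSums (2 * ρ + e + 2) M).ncard : ℝ) ≤ C₁ + 2 *
              ∑ b ∈ Finset.range M, ((S.unitSums (2 * ρ + e) b).ncard : ℝ) +
                C₁ * (M + 1) * (S.unitSums (2 * (ρ - 1) + e) M).ncard := by
            exact_mod_cast h
          have h2 := mul_le_mul_of_nonneg_left (hbd M)
            (by positivity : 0 ≤ (C₁ : ℝ) * (M + 1))
          have h3 : (C₁ : ℝ) * (M + 1) * (C₂ * ((M : ℝ) + 1) ^ (ρ - 1)) =
              C₁ * C₂ * ((M : ℝ) + 1) ^ ρ := by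
            conv_rhs => rw [← Nat.sub_add_cancel hρ, pow_succ]
            ring
          have h4 := mul_le_mul_of_nonneg_left (hone M) hC₁
          linarith
      obtain ⟨E, hE, hfin⟩ := exists_asymptotic_of_sum_bounds
        (g := fun b => ((S.unitSums (2 * ρ + e) b).ncard : ℝ))
        (h := fun M => ((S.unitSums (2 * ρ + e + 2) M).ncard : ℝ)) (G := G)
        hA0 hC hD hmain hupD (fun M => by exact_mod_cast hlow M)
      refine ⟨E, hE, fun M => ?_⟩
      have h := hfin M
      have hcoef : c / ((ρ + 1).factorial : ℝ) * 2 ^ (ρ + 1) = 2 * A / (ρ + 1) := by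
        rw [hA, Nat.factorial_succ]
        push_cast
        field_simp
        ring
      rw [hcoef, show 2 * (ρ + 1) + e = 2 * ρ + e + 2 by ring, Nat.add_sub_cancel]
      refine h.trans ?_
      have h1 : 0 ≤ E * ((M : ℝ) + 1) ^ ρ := by positivity
      have h2 : 0 ≤ E * ((M : ℝ) + 1) ^ ρ * ρ := by positivity
      push_cast
      linarith
    · intro _
      refine ⟨A + C * ρ, by positivity, fun M => ?_⟩
      rw [Nat.add_sub_cancel]
      have h1 := (abs_le.1 (hmain M)).2
      have hM : (0 : ℝ) ≤ M := Nat.cast_nonneg _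
      have h2 : (M : ℝ) ^ ρ ≤ ((M : ℝ) + 1) ^ ρ := pow_le_pow_left₀ hM (by linarith) _
      have h3 := mul_le_mul_of_nonneg_left h2 hA0
      have h4 : C * ρ * ((M : ℝ) + 1) ^ (ρ - 1) ≤ C * ρ * ((M : ℝ) + 1) ^ ρ :=
        mul_le_mul_of_nonneg_left (pow_le_pow_right₀ (by linarith) (Nat.sub_le _ _))
          (by positivity)
      linarith

/-- The integers `|n| ≤ X` that are sums of at most `k` units. -/
def boundedUnitSums (R : Type*) [CommRing R] (k : ℕ) (X : ℝ) : Set ℤ :=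
  {n | |(n : ℝ)| ≤ X ∧ ∃ s : Multiset Rˣ, s.card ≤ k ∧ unitSum s = n}

/-- Bounding the size of an integer amounts to bounding the exponents. -/
theorem ncard_boundedUnitSums_bounds (k : ℕ) : ∃ D : ℕ, ∀ X : ℝ, 1 ≤ X →
    (D ≤ ⌊Real.logb (S.φ S.η) X⌋₊ →
      (S.unitSums k (⌊Real.logb (S.φ S.η) X⌋₊ - D : ℕ)).ncard ≤
        (boundedUnitSums R k X).ncard) ∧
    (boundedUnitSums R k X).ncard ≤
      (S.unitSums k (⌊Real.logb (S.φ S.η) X⌋₊ + D : ℕ)).ncard := by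
  have hq := S.φ_η_pos
  have hq1 := S.one_lt
  obtain ⟨G, hG, hkG⟩ := S.exists_gap_length k
  lift G to ℕ using by linarith
  obtain ⟨D₀, hD₀⟩ := pow_unbounded_of_one_lt (2 * (k : ℝ)) hq1
  refine ⟨D₀ + (k * G + 1) + ((k + 1) * G + 1), fun X hX => ?_⟩
  set D := D₀ + (k * G + 1) + ((k + 1) * G + 1) with hD
  have hX0 : 0 < X := by linarith
  set y := Real.logb (S.φ S.η) X
  have hy0 : 0 ≤ y := Real.logb_nonneg hq1 hX
  have hqy : S.φ S.η ^ y = X := Real.rpow_logb hq hq1.ne' hX0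
  have hfl : S.φ S.η ^ ⌊y⌋₊ ≤ X := by
    rw [← Real.rpow_natCast]
    exact (Real.rpow_le_rpow_of_exponent_le hq1.le (Nat.floor_le hy0)).trans_eq hqy
  have hfl' : X ≤ S.φ S.η ^ (⌊y⌋₊ + 1) := by
    rw [← Real.rpow_natCast]
    refine hqy.symm.trans_le (Real.rpow_le_rpow_of_exponent_le hq1.le ?_)
    push_cast
    exact (Nat.lt_floor_add_one y).le
  have hsub : boundedUnitSums R k X ⊆ S.unitSums k (⌊y⌋₊ + D : ℕ) := by
    rintro n ⟨hnX, s, hs, hsn⟩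
    refine S.mem_unitSums_of_abs_lt hG hkG ?_ ?_ s hs hsn
    · rw [hD]
      push_cast
      have : (0 : ℤ) ≤ k * G := by positivity
      linarith [Int.natCast_nonneg ⌊y⌋₊, Int.natCast_nonneg D₀]
    · have h1 : S.φ S.η ^ (⌊y⌋₊ + 1) * S.φ S.η ^ D₀ ≤
          S.φ S.η ^ (((⌊y⌋₊ + D : ℕ) : ℤ) - k * G) := by
        rw [← pow_add, ← zpow_natCast]
        refine S.zpow_le ?_
        rw [hD]
        push_cast
        have : (0 : ℤ) ≤ (k + 1) * G := by positivity
        linarith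
      refine lt_of_lt_of_le ?_ h1
      rw [mul_comm]
      exact mul_lt_mul' (hnX.trans hfl') hD₀ (by positivity) (by positivity)
  refine ⟨fun hDy => ?_, Set.ncard_le_ncard hsub (S.finite_unitSums _ _)⟩
  refine Set.ncard_le_ncard ?_ ((S.finite_unitSums _ _).subset hsub)
  intro n hn
  refine ⟨?_, ?_⟩
  · refine (S.abs_le_of_mem_unitSums hn).trans (le_trans ?_ hfl)
    have h1 : (k : ℝ) ≤ S.φ S.η ^ D := by
      refine le_trans ?_ (pow_le_pow_right₀ hq1.le (by omega : D₀ ≤ D))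
      linarith [Nat.cast_nonneg (α := ℝ) k]
    rw [zpow_natCast]
    calc (k : ℝ) * S.φ S.η ^ (⌊y⌋₊ - D) ≤ S.φ S.η ^ D * S.φ S.η ^ (⌊y⌋₊ - D) := by gcongr
      _ = S.φ S.η ^ ⌊y⌋₊ := by rw [← pow_add, Nat.add_sub_cancel' hDy]
  · obtain ⟨s, h1, -, h3⟩ := hn
    exact ⟨s, h1, h3⟩

include S in
theorem ncard_boundedUnitSums_one {X : ℝ} (hX : 1 ≤ X) : (boundedUnitSums R 1 X).ncard = 3 := by
  have : boundedUnitSums R 1 X = {-1, 0, 1} := by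
    ext n
    constructor
    · rintro ⟨-, s, h1, h3⟩
      simpa using S.eq_of_unitSum_card_le_one h1 h3
    · intro h
      have h : n = -1 ∨ n = 0 ∨ n = 1 := by simpa using h
      obtain ⟨s, h1, -, h3⟩ := S.exists_unitSum_card_le_one h
      refine ⟨?_, s, h1, h3⟩
      rcases h with rfl | rfl | rfl
      · simpa using hX
      · simpa using zero_le_one.trans hX
      · simpa using hX
  rw [this, Set.ncard_eq_three]
  exact ⟨-1, 0, 1, by norm_num, by norm_num, by norm_num, rfl⟩

theorem exists_sum_units_iff (k : ℕ) (x : R) :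
    (∃ r : ℕ, r ≤ k ∧ ∃ u : Fin r → Rˣ, x = ∑ i, (u i : R)) ↔
      ∃ s : Multiset Rˣ, s.card ≤ k ∧ unitSum s = x := by
  constructor
  · rintro ⟨r, hr, u, rfl⟩
    refine ⟨Finset.univ.val.map u, by simpa using hr, ?_⟩
    simp [unitSum, Finset.sum]
    rfl
  · rintro ⟨s, hs, rfl⟩
    induction s using Quotient.inductionOn with
    | _ l =>
      refine ⟨l.length, hs, l.get, ?_⟩
      simp [unitSum]

theorem boundedUnitSums_asymptotic (k : ℕ) (hk : 1 ≤ k) :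
    ∃ C : ℝ, 0 < C ∧ ∀ X : ℝ, 2 ≤ X →
      |((boundedUnitSums R k X).ncard : ℝ) - (if Even k then (1 : ℝ) else 3) /
          (Nat.factorial (k / 2)) * (2 * Real.log X / Real.log (S.φ S.η)) ^ (k / 2)|
        ≤ C * Real.log X ^ (((k / 2 : ℕ) : ℝ) - 1) := by
  have hlog2 : 0 < Real.log 2 := Real.log_pos one_lt_two
  rcases Nat.eq_zero_or_pos (k / 2) with h0 | hpos
  · obtain rfl : k = 1 := by omega
    refine ⟨1, one_pos, fun X hX => ?_⟩
    rw [S.ncard_boundedUnitSums_one (by linarith)]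
    have : 0 ≤ Real.log X := Real.log_nonneg (by linarith)
    simpa using Real.rpow_nonneg this _
  obtain ⟨r, hr⟩ : ∃ r, k / 2 = r + 1 := ⟨k / 2 - 1, by omega⟩
  obtain ⟨C, hC, hmain⟩ := S.ncard_unitSums_asymptotic (k / 2) (k % 2) (by omega)
  obtain ⟨D, hD⟩ := S.ncard_boundedUnitSums_bounds k
  have hc : (if k % 2 = 0 then (1 : ℝ) else 3) = if Even k then 1 else 3 := by
    simp only [Nat.even_iff]
  rw [Nat.div_add_mod, hc, hr, Nat.add_sub_cancel] at hmain
  rw [hr]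
  set c : ℝ := if Even k then 1 else 3 with hc'
  have hc0 : 0 ≤ c := by rw [hc']; split_ifs <;> norm_num
  set B : ℝ := c / ((r + 1).factorial : ℝ) * 2 ^ (r + 1) with hB
  have hB0 : 0 ≤ B := by positivity
  have hlogη : 0 < Real.log (S.φ S.η) := Real.log_pos S.one_lt
  set E : ℝ := 1 / Real.log (S.φ S.η) + (D + 2) / Real.log 2 with hE
  have hE0 : 0 ≤ E := by positivity
  have hC' : 0 ≤ C * (r + 1 : ℕ) := by positivity
  refine ⟨(B * ((D + 1) * (r + 1)) + C * (r + 1 : ℕ)) * E ^ r + 1, by positivity, fun X hX => ?_⟩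
  have hlogX : Real.log 2 ≤ Real.log X := Real.log_le_log two_pos hX
  have hlogX0 : 0 < Real.log X := hlog2.trans_le hlogX
  obtain ⟨hlow, hup⟩ := hD X (by linarith)
  set y := Real.logb (S.φ S.η) X with hy
  have hy0 : 0 ≤ y := Real.logb_nonneg S.one_lt (by linarith)
  have hfl := Nat.floor_le hy0
  have hfl' := Nat.lt_floor_add_one y
  have hbound := abs_sub_mul_pow_le (N := (boundedUnitSums R k X).ncard) (D := (D : ℝ) + 1)
    (M₁ := ⌊y⌋₊ - D) (M₂ := ⌊y⌋₊ + D) (r := r) hB0 hC' hy0 ?_ ?_ ?_ ?_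
  · have hyE : y + (D + 1) + 1 ≤ E * Real.log X := by
      have h1 : (D : ℝ) + 2 ≤ (D + 2) / Real.log 2 * Real.log X := by
        rw [div_mul_eq_mul_div, le_div_iff₀ hlog2]
        gcongr
      rw [hE, add_mul, hy, Real.logb, div_mul_eq_mul_div, one_mul]
      linarith
    rw [show c / ((r + 1).factorial : ℝ) * (2 * Real.log X / Real.log (S.φ S.η)) ^ (r + 1) =
      B * y ^ (r + 1) by rw [hB, hy, Real.logb, mul_div_assoc, mul_pow]; ring]
    refine hbound.trans ?_
    rw [show (((r + 1 : ℕ) : ℝ) - 1) = (r : ℝ) by push_cast; ring, Real.rpow_natCast]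
    calc _ ≤ (B * ((D + 1) * (r + 1)) + C * (r + 1 : ℕ)) * (E * Real.log X) ^ r := by gcongr
      _ = (B * ((D + 1) * (r + 1)) + C * (r + 1 : ℕ)) * E ^ r * Real.log X ^ r := by
        rw [mul_pow E, ← mul_assoc]
      _ ≤ _ := by
        gcongr
        linarith
  · rcases le_total D ⌊y⌋₊ with h | h
    · rw [Nat.cast_sub h, abs_le]
      constructor <;> linarith [Nat.cast_nonneg (α := ℝ) D]
    · rw [Nat.sub_eq_zero_of_le h, Nat.cast_zero, zero_sub, abs_neg, abs_of_nonneg hy0]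
      have : (⌊y⌋₊ : ℝ) ≤ D := by exact_mod_cast h
      linarith
  · rw [Nat.cast_add, abs_le]
    constructor <;> linarith [Nat.cast_nonneg (α := ℝ) D]
  · rcases le_total D ⌊y⌋₊ with h | h
    · have h1 := (abs_le.1 (hmain (⌊y⌋₊ - D))).1
      have h2 : ((S.unitSums k (⌊y⌋₊ - D : ℕ)).ncard : ℝ) ≤ (boundedUnitSums R k X).ncard := by
        exact_mod_cast hlow h
      linarith
    · rw [Nat.sub_eq_zero_of_le h, Nat.cast_zero, zero_pow r.succ_ne_zero, mul_zero, zero_add,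
        one_pow, mul_one, zero_sub]
      linarith [Nat.cast_nonneg (α := ℝ) (boundedUnitSums R k X).ncard]
  · have h1 := (abs_le.1 (hmain (⌊y⌋₊ + D))).2
    have h2 : ((boundedUnitSums R k X).ncard : ℝ) ≤ (S.unitSums k (⌊y⌋₊ + D : ℕ)).ncard := by
      exact_mod_cast hup
    linarith

end RealQuadraticUnits

/-- Theorem 1 (main theorem): asymptotics for the number of integers `|n| ≤ X` that are
sums of at most `k` units of the ring of integers of a real quadratic field. -/
theorem sums_of_at_most_k_units_asymptotic
    (d : ℕ) (hd : 2 ≤ d) (hsf : Squarefree d)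
    (L : IntermediateField ℚ ℝ) (hL : L = ℚ⟮(Real.sqrt d)⟯)
    (η : (𝓞 L)ˣ) (hη : 1 < emb L η)
    (hfund : ∀ ε : (𝓞 L)ˣ, 1 < emb L ε → emb L η ≤ emb L ε)
    (k : ℕ) (hk : 1 ≤ k) :
    ∃ C : ℝ, 0 < C ∧ ∀ X : ℝ, 2 ≤ X →
      |(Set.ncard {n : ℤ | (|n| : ℝ) ≤ X ∧ ∃ r : ℕ, r ≤ k ∧ ∃ u : Fin r → (𝓞 L)ˣ,
            (n : 𝓞 L) = ∑ i, (u i : 𝓞 L)} : ℝ)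
          - (if Even k then (1 : ℝ) else 3) / (Nat.factorial (k / 2))
              * (2 * Real.log X / Real.log (emb L η)) ^ (k / 2)|
        ≤ C * Real.log X ^ (((k / 2 : ℕ) : ℝ) - 1) := by
  subst hL
  obtain ⟨S, hS⟩ := exists_realQuadraticUnits _ (finrank_adjoin_sqrt d hd hsf) η hη hfund
  obtain ⟨C, hC, h⟩ := S.boundedUnitSums_asymptotic k hk
  refine ⟨C, hC, fun X hX => ?_⟩
  have h' := h X hX
  rw [hS] at h'
  simpa only [RealQuadraticUnits.exists_sum_units_iff, RealQuadraticUnits.boundedUnitSums] using h'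
end

section
/- Let L = ℚ(√d) be a real quadratic field (d ≥ 2 squarefree). There exists a chain of finite subsets 𝒰_0 ⊆ 𝒰_1 ⊆ 𝒰_2 ⊆ ⋯ of O_L^×, depending only on L, with the following property: whenever r ∈ ℕ, n ∈ ℤ∖{0}, and u = (u_1,…,u_r) ∈ (O_L^×)^r satisfy n = u_1 + ⋯ + u_r with no vanishing subsum, then there exist ℓ, s ∈ ℕ_0 with 2ℓ + s ≤ r, a tuple v = (v_1,…,v_ℓ) ∈ (O_L^×)^ℓ, and a tuple ξ = (ξ_1,…,ξ_s) ∈ 𝒰_s^s, such that n = v_1 + ⋯ + v_ℓ + v_1' + ⋯ + v_ℓ' + ξ_1 + ⋯ + ξ_s. -/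
open NumberField IntermediateField

/-- A family of elements of an additive monoid has no vanishing subsum if the sum over
every nonempty (finite) subset of indices is nonzero. -/
def NoVanishingSubsum {ι R : Type*} [AddCommMonoid R] (w : ι → R) : Prop :=
  ∀ I : Finset ι, I.Nonempty → ∑ i ∈ I, w i ≠ 0

section Quadratic

variable {L : IntermediateField ℚ ℝ}

theorem isQuadraticExtension_of_eq_adjoin_sqrt {d : ℕ} (hL : L = ℚ⟮Real.sqrt d⟯)
    {σ : L ≃ₐ[ℚ] L} (hσ : σ ≠ AlgEquiv.refl) : Algebra.IsQuadraticExtension ℚ L := by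
  have hroot : Polynomial.aeval (Real.sqrt d) (Polynomial.X ^ 2 - Polynomial.C (d : ℚ)) = 0 := by
    simp
  have hmonic : (Polynomial.X ^ 2 - Polynomial.C (d : ℚ)).Monic :=
    Polynomial.monic_X_pow_sub_C _ two_ne_zero
  have hint : IsIntegral ℚ (Real.sqrt d) := ⟨_, hmonic, hroot⟩
  have hrank : Module.finrank ℚ L ≤ 2 := by
    subst hL
    rw [adjoin.finrank hint]
    refine (Polynomial.natDegree_le_natDegree (minpoly.min ℚ _ hmonic hroot)).trans ?_
    rw [Polynomial.natDegree_X_pow_sub_C]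
  have : FiniteDimensional ℚ L := by
    subst hL
    exact adjoin.finiteDimensional hint
  have hpos : 0 < Module.finrank ℚ L := Module.finrank_pos
  have hne : Module.finrank ℚ L ≠ 1 := by
    intro h1
    refine hσ (AlgEquiv.ext fun x => ?_)
    obtain ⟨q, hq⟩ := Algebra.mem_bot.1
      (Subalgebra.bot_eq_top_of_finrank_eq_one h1 ▸ Algebra.mem_top :
        x ∈ (⊥ : Subalgebra ℚ L))
    rw [← hq]
    simp
  exact { finrank_eq_two' := by omega }

variable [Algebra.IsQuadraticExtension ℚ L] {σ : L ≃ₐ[ℚ] L}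

theorem univ_eq_pair_of_ne_refl [DecidableEq (L ≃ₐ[ℚ] L)] (hσ : σ ≠ AlgEquiv.refl) :
    (Finset.univ : Finset (L ≃ₐ[ℚ] L)) = {AlgEquiv.refl, σ} := by
  symm
  rw [← Finset.card_eq_iff_eq_univ, Finset.card_pair hσ.symm, ← Nat.card_eq_fintype_card,
    IsGalois.card_aut_eq_finrank, Algebra.IsQuadraticExtension.finrank_eq_two]

theorem algebraMap_norm_eq_mul_conj (hσ : σ ≠ AlgEquiv.refl) (x : L) :
    algebraMap ℚ L (Algebra.norm ℚ x) = x * σ x := by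
  classical
  rw [Algebra.norm_eq_prod_automorphisms, univ_eq_pair_of_ne_refl hσ,
    Finset.prod_pair hσ.symm, AlgEquiv.coe_refl, id]

theorem algebraMap_trace_eq_add_conj (hσ : σ ≠ AlgEquiv.refl) (x : L) :
    algebraMap ℚ L (Algebra.trace ℚ L x) = x + σ x := by
  classical
  rw [trace_eq_sum_automorphisms, univ_eq_pair_of_ne_refl hσ,
    Finset.sum_pair hσ.symm, AlgEquiv.coe_refl, id]

theorem conj_conj (hσ : σ ≠ AlgEquiv.refl) (x : L) : σ (σ x) = x := by
  have h := congrArg σ (algebraMap_trace_eq_add_conj hσ x)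
  rw [AlgEquiv.commutes, algebraMap_trace_eq_add_conj hσ, map_add, add_comm] at h
  exact (add_left_cancel h).symm

theorem one_le_abs_mul_abs_conj (hσ : σ ≠ AlgEquiv.refl) {x : L} (hx : IsIntegral ℤ x)
    (hx0 : x ≠ 0) : 1 ≤ |(x : ℝ)| * |(σ x : ℝ)| := by
  obtain ⟨z, hz⟩ := IsIntegrallyClosed.isIntegral_iff.1 (Algebra.isIntegral_norm ℚ hx)
  have h : (z : L) = x * σ x := by
    rw [← algebraMap_norm_eq_mul_conj hσ, ← hz]
    simp
  have hz0 : z ≠ 0 := by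
    rintro rfl
    rw [Int.cast_zero, eq_comm] at h
    simp [hx0] at h
  have h' : (z : ℝ) = x * σ x := by exact_mod_cast congrArg (algebraMap L ℝ) h
  rw [← abs_mul, ← h']
  exact_mod_cast Int.one_le_abs hz0

theorem abs_mul_abs_conj_unit (hσ : σ ≠ AlgEquiv.refl) (u : (𝓞 L)ˣ) :
    |(((u : 𝓞 L) : L) : ℝ)| * |(σ ((u : 𝓞 L) : L) : ℝ)| = 1 := by
  have key (v : (𝓞 L)ˣ) : 1 ≤ |(((v : 𝓞 L) : L) : ℝ)| * |(σ ((v : 𝓞 L) : L) : ℝ)| :=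
    one_le_abs_mul_abs_conj hσ (v : 𝓞 L).isIntegral_coe (by simp)
  have hmul : ((u : 𝓞 L) : L) * ((u⁻¹ : (𝓞 L)ˣ) : 𝓞 L) = 1 := by
    rw [← map_mul, Units.mul_inv, map_one]
  have h1 : |(((u : 𝓞 L) : L) : ℝ)| * |((((u⁻¹ : (𝓞 L)ˣ) : 𝓞 L) : L) : ℝ)| = 1 := by
    rw [← abs_mul]
    simpa only [MulMemClass.coe_mul, OneMemClass.coe_one, abs_one] using
      congrArg (fun x : L => |(x : ℝ)|) hmul
  have h2 : |(σ ((u : 𝓞 L) : L) : ℝ)| * |(σ (((u⁻¹ : (𝓞 L)ˣ) : 𝓞 L) : L) : ℝ)| = 1 := by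
    rw [← abs_mul]
    simpa only [map_mul, map_one, MulMemClass.coe_mul, OneMemClass.coe_one, abs_one] using
      congrArg (fun x : L => |(σ x : ℝ)|) hmul
  refine le_antisymm ?_ (key u)
  have hu := key u
  have hv := key u⁻¹
  refine (le_mul_of_one_le_right (zero_le_one.trans hu) hv).trans_eq ?_
  rw [mul_mul_mul_comm, h1, h2, one_mul]

theorem finite_units_abs_le (hσ : σ ≠ AlgEquiv.refl) (C : ℝ) :
    {u : (𝓞 L)ˣ | |(((u : 𝓞 L) : L) : ℝ)| ≤ C ∧ |(σ ((u : 𝓞 L) : L) : ℝ)| ≤ C}.Finite := by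
  have : NumberField L := ⟨⟩
  refine Set.Finite.of_finite_image (f := fun u : (𝓞 L)ˣ => ((u : 𝓞 L) : L)) ?_ ?_
  · refine (Embeddings.finite_of_norm_le L ℂ C).subset ?_
    rintro _ ⟨u, ⟨h1, h2⟩, rfl⟩
    refine ⟨(u : 𝓞 L).isIntegral_coe, fun φ => ?_⟩
    set x : L := ((u : 𝓞 L) : L)
    have hN := algebraMap_norm_eq_mul_conj hσ x
    have hT := algebraMap_trace_eq_add_conj hσ x
    let ψ : L →+* ℂ := Complex.ofRealHom.comp (algebraMap L ℝ)
    have hψ (y : L) : ‖ψ y‖ = |(y : ℝ)| := by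
      simp [ψ]
    have hN' : φ x * φ (σ x) = ψ x * ψ (σ x) := by
      rw [← map_mul, ← map_mul, ← hN]; simp
    have hT' : φ x + φ (σ x) = ψ x + ψ (σ x) := by
      rw [← map_add, ← map_add, ← hT]; simp
    have hprod : (φ x - ψ x) * (φ x - ψ (σ x)) = 0 := by
      linear_combination φ x * hT' - hN'
    rcases mul_eq_zero.1 hprod with h | h
    · rw [sub_eq_zero.1 h, hψ]; exact h1
    · rw [sub_eq_zero.1 h, hψ]; exact h2
  · intro u _ v _ h
    exact Units.ext (RingOfIntegers.ext h)

end Quadratic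

theorem exists_minimal_vanishing_subsum {ι M : Type*} [AddCommGroup M] {f : ι → M}
    {S : Finset ι} (hS : ∑ i ∈ S, f i = 0) {i₀ : ι} (hi₀ : i₀ ∈ S) :
    ∃ T ⊆ S, i₀ ∈ T ∧ ∑ i ∈ T, f i = 0 ∧
      ∀ T' ⊂ T, T'.Nonempty → ∑ i ∈ T', f i ≠ 0 := by
  classical
  obtain ⟨T, hT, hmin⟩ := Finset.exists_min_image
    (S.powerset.filter fun T => i₀ ∈ T ∧ ∑ i ∈ T, f i = 0) Finset.card
    ⟨S, by simp [hi₀, hS]⟩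
  simp only [Finset.mem_filter, Finset.mem_powerset, and_imp] at hT hmin
  refine ⟨T, hT.1, hT.2.1, hT.2.2, fun T' hT' hne h0 => ?_⟩
  by_cases hi : i₀ ∈ T'
  · exact (Finset.card_lt_card hT').not_ge (hmin T' (hT'.1.trans hT.1) hi h0)
  · refine (hmin (T \ T') (Finset.sdiff_subset.trans hT.1)
      (Finset.mem_sdiff.2 ⟨hT.2.1, hi⟩) ?_).not_gt ?_
    · rw [Finset.sum_sdiff_eq_sub hT'.1, hT.2.2, h0, sub_zero]
    · rw [Finset.card_sdiff_of_subset hT'.1]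
      have := hne.card_pos
      have := Finset.card_le_card hT'.1
      omega

section Gap

variable {L : IntermediateField ℚ ℝ} [Algebra.IsQuadraticExtension ℚ L] {σ : L ≃ₐ[ℚ] L}

/-- A vanishing sum of units of a real quadratic field cannot be split by a large gap between
absolute values, unless it has a proper vanishing subsum. -/
theorem exists_abs_le_of_minimal_vanishing (hσ : σ ≠ AlgEquiv.refl) {ι : Type*} [DecidableEq ι]
    {w : ι → L} {T A : Finset ι} (hw : ∀ i, IsIntegral ℤ (w i))
    (hw1 : ∀ i, |(w i : ℝ)| * |(σ (w i) : ℝ)| = 1) (hT : ∑ i ∈ T, w i = 0)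
    (hmin : ∀ T' ⊂ T, T'.Nonempty → ∑ i ∈ T', w i ≠ 0)
    (hA : A ⊂ T) (hA0 : A.Nonempty) {B : ℝ} (hB : 0 < B) (hAB : ∀ i ∈ A, |(w i : ℝ)| ≤ B) :
    ∃ i ∈ T \ A, |(w i : ℝ)| ≤ B * ((T.card : ℝ) ^ 2 + 1) := by
  by_contra! hcon
  set N : ℝ := (T.card : ℝ)
  have hN : 0 ≤ N := Nat.cast_nonneg _
  set q : L := ∑ i ∈ T \ A, w i with hq
  have hqA : q = -∑ i ∈ A, w i := by
    rw [hq, Finset.sum_sdiff_eq_sub hA.1, hT, zero_sub]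
  have hq0 : q ≠ 0 := by
    rw [hqA]
    exact neg_ne_zero.2 (hmin A hA hA0)
  have hbound (S : Finset ι) (hS : S ⊆ T) (f : ι → L) (c : ℝ) (hc : 0 ≤ c)
      (h : ∀ i ∈ S, |(f i : ℝ)| ≤ c) : |((∑ i ∈ S, f i : L) : ℝ)| ≤ N * c := by
    calc |((∑ i ∈ S, f i : L) : ℝ)| = |∑ i ∈ S, (f i : ℝ)| := by
          congr 1
          exact map_sum (algebraMap L ℝ) f S
      _ ≤ ∑ i ∈ S, |(f i : ℝ)| := Finset.abs_sum_le_sum_abs _ _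
      _ ≤ S.card • c := Finset.sum_le_card_nsmul _ _ _ h
      _ ≤ N * c := by
        rw [nsmul_eq_mul]
        gcongr
        exact Nat.cast_le.2 (Finset.card_le_card hS)
  have h1 : |(q : ℝ)| ≤ N * B := by
    have := hbound A hA.1 w B hB.le hAB
    rw [hqA]
    simpa using this
  have h2 : |(σ q : ℝ)| ≤ N * (B * (N ^ 2 + 1))⁻¹ := by
    rw [hq, map_sum]
    refine hbound (T \ A) Finset.sdiff_subset _ _ (by positivity) fun i hi => ?_
    rw [eq_inv_of_mul_eq_one_right (hw1 i)]
    exact inv_anti₀ (by positivity) (hcon i hi).le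
  have h3 := one_le_abs_mul_abs_conj hσ (IsIntegral.sum _ fun i _ => hw i) hq0
  have h4 : |(q : ℝ)| * |(σ q : ℝ)| ≤ N ^ 2 / (N ^ 2 + 1) := by
    calc _ ≤ (N * B) * (N * (B * (N ^ 2 + 1))⁻¹) := by gcongr
      _ = _ := by field_simp
  have h5 : N ^ 2 / (N ^ 2 + 1) < 1 := by
    rw [div_lt_one (by positivity)]
    linarith
  exact absurd (h3.trans h4) (not_le.2 h5)

theorem abs_le_mul_abs_of_minimal_vanishing (hσ : σ ≠ AlgEquiv.refl) {ι : Type*}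
    {w : ι → L} {T : Finset ι} (hw : ∀ i, IsIntegral ℤ (w i))
    (hw1 : ∀ i, |(w i : ℝ)| * |(σ (w i) : ℝ)| = 1) (hT : ∑ i ∈ T, w i = 0)
    (hmin : ∀ T' ⊂ T, T'.Nonempty → ∑ i ∈ T', w i ≠ 0)
    {i j : ι} (hi : i ∈ T) (hj : j ∈ T) :
    |(w i : ℝ)| ≤ |(w j : ℝ)| * ((T.card : ℝ) ^ 2 + 1) ^ T.card := by
  classical
  set R : ℝ := (T.card : ℝ) ^ 2 + 1 with hR
  have hR1 : 1 ≤ R := by rw [hR]; nlinarith [sq_nonneg (T.card : ℝ)]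
  have hpos : 0 < |(w j : ℝ)| := by
    have := hw1 j
    refine lt_of_le_of_ne (abs_nonneg _) fun h => ?_
    rw [← h, zero_mul] at this
    exact zero_ne_one this
  let A (k : ℕ) : Finset ι := T.filter fun i => |(w i : ℝ)| ≤ |(w j : ℝ)| * R ^ k
  have hAsub (k : ℕ) : A k ⊆ T := Finset.filter_subset _ _
  have hcard (k : ℕ) : A k = T ∨ k + 1 ≤ (A k).card := by
    induction k with
    | zero =>
      exact .inr (Finset.card_pos.2 ⟨j, Finset.mem_filter.2 ⟨hj, by simp⟩⟩)
    | succ k ih =>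
      have hmono : A k ⊆ A (k + 1) := by
        refine Finset.monotone_filter_right _ fun i _ h => h.trans ?_
        gcongr
        omega
      rcases ih with h | h
      · exact .inl (Finset.Subset.antisymm (hAsub _) (h ▸ hmono))
      · by_cases hAT : A k = T
        · exact .inl (Finset.Subset.antisymm (hAsub _) (hAT ▸ hmono))
        · obtain ⟨i, hi, hle⟩ := exists_abs_le_of_minimal_vanishing hσ hw hw1 hT hmin
            ((hAsub k).ssubset_of_ne hAT) (Finset.card_pos.1 (by omega))
            (B := |(w j : ℝ)| * R ^ k) (by positivity)
            fun i hi => (Finset.mem_filter.1 hi).2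
          rw [Finset.mem_sdiff] at hi
          refine .inr (Nat.succ_le_of_lt (h.trans_lt (Finset.card_lt_card
            (Finset.ssubset_iff_of_subset hmono |>.2 ⟨i, ?_, hi.2⟩))))
          exact Finset.mem_filter.2 ⟨hi.1, by rw [pow_succ, ← mul_assoc]; exact hle⟩
  have hfull : A T.card = T := by
    refine (hcard T.card).resolve_right fun h => ?_
    have := Finset.card_le_card (hAsub T.card)
    omega
  exact (Finset.mem_filter.1 (hfull.symm ▸ hi : i ∈ A T.card)).2

end Gap

section Reduction

variable {L : IntermediateField ℚ ℝ} {σ : L ≃ₐ[ℚ] L}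

/-- The trace sum over `D` together with the plain sum over `S` represents `n`, with at most
`Fintype.card ι` summands. -/
structure IsTraceRep {ι : Type*} [Fintype ι] (σ : L ≃ₐ[ℚ] L) (w : ι → L) (n : ℤ)
    (D S : Finset ι) : Prop where
  disjoint : Disjoint D S
  card_le : 2 * D.card + S.card ≤ Fintype.card ι
  eq_sum : (n : L) = ∑ i ∈ D, w i + ∑ i ∈ D, σ (w i) + ∑ i ∈ S, w i

theorem IsTraceRep.reduce {ι : Type*} [Fintype ι] [DecidableEq ι] {w : ι → L} {n : ℤ}
    {D S I J : Finset ι} (h : IsTraceRep σ w n D S) (hI : I ⊆ S) (hJ : J ⊆ S)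
    (hIJ : Disjoint I J) (hcard : J.card ≤ I.card)
    (hsum : ∑ i ∈ I, w i = ∑ j ∈ J, σ (w j)) :
    IsTraceRep σ w n (D ∪ J) (S \ (I ∪ J)) := by
  have hDJ : Disjoint D J := h.disjoint.mono_right hJ
  have hsub : I ∪ J ⊆ S := Finset.union_subset hI hJ
  refine ⟨?_, ?_, ?_⟩
  · rw [Finset.disjoint_union_left]
    exact ⟨h.disjoint.mono_right Finset.sdiff_subset,
      Finset.disjoint_sdiff.mono_left Finset.subset_union_right⟩
  · rw [Finset.card_union_of_disjoint hDJ, Finset.card_sdiff_of_subset hsub]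
    have h1 := h.card_le
    have h2 := Finset.card_le_card hsub
    rw [Finset.card_union_of_disjoint hIJ] at h2 ⊢
    omega
  · rw [h.eq_sum, Finset.sum_union hDJ, Finset.sum_union hDJ, Finset.sum_sdiff_eq_sub hsub,
      Finset.sum_union hIJ, hsum]
    ring

variable [Algebra.IsQuadraticExtension ℚ L]

theorem IsTraceRep.sum_eq_sum_conj (hσ : σ ≠ AlgEquiv.refl) {ι : Type*} [Fintype ι] {w : ι → L}
    {n : ℤ} {D S : Finset ι} (h : IsTraceRep σ w n D S) :
    ∑ i ∈ S, w i = ∑ i ∈ S, σ (w i) := by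
  have h1 := h.eq_sum
  have h2 := congrArg σ h1
  simp only [map_intCast, map_add, map_sum, conj_conj hσ] at h2
  linear_combination h2 - h1

theorem IsTraceRep.abs_le_of_minimal (hσ : σ ≠ AlgEquiv.refl) {ι : Type*} [Fintype ι]
    {w : ι → L} (hw : ∀ i, IsIntegral ℤ (w i))
    (hw1 : ∀ i, |(w i : ℝ)| * |(σ (w i) : ℝ)| = 1) {n : ℤ}
    {D S : Finset ι} (h : IsTraceRep σ w n D S)
    (hmin : ∀ D' S', IsTraceRep σ w n D' S' → S.card ≤ S'.card) {i : ι} (hi : i ∈ S) :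
    |(w i : ℝ)| ≤ (((2 * S.card : ℕ) : ℝ) ^ 2 + 1) ^ (2 * S.card) ∧
      |(σ (w i) : ℝ)| ≤ (((2 * S.card : ℕ) : ℝ) ^ 2 + 1) ^ (2 * S.card) := by
  classical
  let f : ι ⊕ ι → L := Sum.elim w fun j => -σ (w j)
  have hf : ∀ k, IsIntegral ℤ (f k) := by
    rintro (k | k)
    · exact hw k
    · exact ((hw k).map σ).neg
  have hf1 : ∀ k, |(f k : ℝ)| * |(σ (f k) : ℝ)| = 1 := by
    rintro (k | k)
    · exact hw1 k
    · simpa [f, conj_conj hσ, mul_comm] using hw1 k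
  have hS : ∑ k ∈ S.disjSum S, f k = 0 := by
    simp [f, Finset.sum_disjSum, h.sum_eq_sum_conj hσ]
  obtain ⟨T, hTS, hiT, hT0, hTmin⟩ :=
    exists_minimal_vanishing_subsum hS (Finset.inl_mem_disjSum.2 hi)
  have hTcard : T.card ≤ 2 * S.card := by
    have := Finset.card_le_card hTS
    rw [Finset.card_disjSum] at this
    omega
  have hratio {k l : ι ⊕ ι} (hk : k ∈ T) (hl : l ∈ T) :
      |(f k : ℝ)| ≤ |(f l : ℝ)| * (((2 * S.card : ℕ) : ℝ) ^ 2 + 1) ^ (2 * S.card) := by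
    refine (abs_le_mul_abs_of_minimal_vanishing hσ hf hf1 hT0 hTmin hk hl).trans ?_
    refine mul_le_mul_of_nonneg_left ((pow_le_pow_left₀ (by positivity) ?_ _).trans
      (pow_le_pow_right₀ (le_add_of_nonneg_left (by positivity)) hTcard)) (abs_nonneg _)
    gcongr
  set C : ℝ := (((2 * S.card : ℕ) : ℝ) ^ 2 + 1) ^ (2 * S.card)
  have hC : 0 < C := by positivity
  have hIS : T.toLeft ⊆ S := fun k hk =>
    Finset.inl_mem_disjSum.1 (hTS (Finset.mem_toLeft.1 hk))
  have hJS : T.toRight ⊆ S := fun k hk =>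
    Finset.inr_mem_disjSum.1 (hTS (Finset.mem_toRight.1 hk))
  have hsum : ∑ k ∈ T.toLeft, w k = ∑ k ∈ T.toRight, σ (w k) := by
    rw [← Finset.toLeft_disjSum_toRight (u := T), Finset.sum_disjSum] at hT0
    simpa [f, ← sub_eq_add_neg, sub_eq_zero] using hT0
  have hiI : i ∈ T.toLeft := Finset.mem_toLeft.2 hiT
  have hmeet : ¬ Disjoint T.toLeft T.toRight := by
    intro hdis
    have hlt : (S \ (T.toLeft ∪ T.toRight)).card < S.card :=
      Finset.card_lt_card (Finset.sdiff_ssubset (Finset.union_subset hIS hJS)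
        ⟨i, Finset.mem_union_left _ hiI⟩)
    rcases le_total T.toRight.card T.toLeft.card with hle | hle
    · exact hlt.not_ge (hmin _ _ (h.reduce hIS hJS hdis hle hsum))
    · have hsum' : ∑ k ∈ T.toRight, w k = ∑ k ∈ T.toLeft, σ (w k) := by
        rw [← map_sum, hsum, map_sum]
        simp only [conj_conj hσ]
      have := hmin _ _ (h.reduce hJS hIS hdis.symm hle hsum')
      rw [Finset.union_comm] at this
      exact hlt.not_ge this
  obtain ⟨j, hjI, hjJ⟩ := Finset.not_disjoint_iff.1 hmeet
  have h1 : |(w i : ℝ)| ≤ |(w j : ℝ)| * C := hratio hiT (Finset.mem_toLeft.1 hjI)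
  have h2 : |(w i : ℝ)| ≤ |(σ (w j) : ℝ)| * C := by
    simpa [f] using hratio hiT (Finset.mem_toRight.1 hjJ)
  have h3 : |(w j : ℝ)| ≤ |(w i : ℝ)| * C := hratio (Finset.mem_toLeft.1 hjI) hiT
  have h4 : |(σ (w j) : ℝ)| ≤ |(w i : ℝ)| * C := by
    simpa [f] using hratio (Finset.mem_toRight.1 hjJ) hiT
  have hj := hw1 j
  have hi1 := hw1 i
  have hmul : |(w i : ℝ)| * |(w i : ℝ)| ≤ C * C := by
    calc _ ≤ (|(w j : ℝ)| * C) * (|(σ (w j) : ℝ)| * C) := by gcongr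
      _ = C * C := by linear_combination (C * C) * hj
  have hmul' : 1 ≤ (|(w i : ℝ)| * C) * (|(w i : ℝ)| * C) := by
    rw [← hj]
    gcongr
  refine ⟨abs_le_of_sq_le_sq' ?_ hC.le |>.2, ?_⟩
  · nlinarith
  · have h5 : 1 ≤ |(w i : ℝ)| * C := by
      by_contra! hlt
      have : 0 ≤ |(w i : ℝ)| * C := by positivity
      nlinarith
    calc |(σ (w i) : ℝ)| ≤ |(σ (w i) : ℝ)| * (|(w i : ℝ)| * C) :=
          le_mul_of_one_le_right (abs_nonneg _) h5
      _ = C := by linear_combination C * hi1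

end Reduction

/-- Proposition 4 (reduction to unit trace sums): there is a chain of finite sets of units
`𝒰₀ ⊆ 𝒰₁ ⊆ ⋯` such that any representation of a nonzero integer `n` as a sum of `r` units
with no vanishing subsum can be replaced by a representation
`n = v₁ + ⋯ + v_ℓ + v₁' + ⋯ + v_ℓ' + ξ₁ + ⋯ + ξ_s` with `2ℓ + s ≤ r` and all `ξ_j ∈ 𝒰_s`. -/
theorem trace_sum_reduction
    (d : ℕ) (hd : 2 ≤ d) (hsf : Squarefree d)
    (L : IntermediateField ℚ ℝ) (hL : L = ℚ⟮(Real.sqrt d)⟯)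
    (σ : L ≃ₐ[ℚ] L) (hσ : σ ≠ AlgEquiv.refl) :
    ∃ U : ℕ → Finset (𝓞 L)ˣ, (∀ t : ℕ, U t ⊆ U (t + 1)) ∧
      ∀ r : ℕ, 1 ≤ r → ∀ n : ℤ, n ≠ 0 → ∀ u : Fin r → (𝓞 L)ˣ,
        (n : L) = ∑ i, ((u i : 𝓞 L) : L) →
        NoVanishingSubsum (fun i : Fin r => ((u i : 𝓞 L) : L)) →
        ∃ ℓ s : ℕ, 2 * ℓ + s ≤ r ∧
          ∃ v : Fin ℓ → (𝓞 L)ˣ, ∃ ξ : Fin s → (𝓞 L)ˣ,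
            (∀ j, ξ j ∈ U s) ∧
            (n : L) = ∑ i, ((v i : 𝓞 L) : L) + ∑ i, σ ((v i : 𝓞 L) : L)
              + ∑ j, ((ξ j : 𝓞 L) : L) := by
  have : Algebra.IsQuadraticExtension ℚ L := isQuadraticExtension_of_eq_adjoin_sqrt hL hσ
  let C (t : ℕ) : ℝ := (((2 * t : ℕ) : ℝ) ^ 2 + 1) ^ (2 * t)
  have hC (t : ℕ) : C t ≤ C (t + 1) := by
    refine (pow_le_pow_left₀ (by positivity) ?_ _).trans
      (pow_le_pow_right₀ (le_add_of_nonneg_left (by positivity)) ?_)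
    · gcongr
      omega
    · omega
  refine ⟨fun t => (finite_units_abs_le hσ (C t)).toFinset, fun t => ?_, ?_⟩
  · intro u hu
    simp only [Set.Finite.mem_toFinset, Set.mem_ofPred_eq] at hu ⊢
    exact ⟨hu.1.trans (hC t), hu.2.trans (hC t)⟩
  intro r _ n _ u hn _
  let w : Fin r → L := fun i => ((u i : 𝓞 L) : L)
  have hex : ∃ s D S, IsTraceRep σ w n D S ∧ S.card = s :=
    ⟨_, ∅, Finset.univ, ⟨by simp, by simp, by simpa [w] using hn⟩, rfl⟩
  classical
  obtain ⟨D, S, h, hS⟩ := Nat.find_spec hex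
  have hmin (D' S') (h' : IsTraceRep σ w n D' S') : S.card ≤ S'.card := by
    rw [hS]
    exact Nat.find_min' hex ⟨D', S', h', rfl⟩
  refine ⟨D.card, S.card, by simpa using h.card_le, fun k => u (D.equivFin.symm k),
    fun k => u (S.equivFin.symm k), fun k => ?_, ?_⟩
  · rw [Set.Finite.mem_toFinset]
    exact h.abs_le_of_minimal hσ (fun i => (u i : 𝓞 L).isIntegral_coe)
      (fun i => abs_mul_abs_conj_unit hσ (u i)) hmin (S.equivFin.symm k).2
  · have hsum (A : Finset (Fin r)) (g : Fin r → L) :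
        ∑ k, g (A.equivFin.symm k) = ∑ i ∈ A, g i := by
      rw [Equiv.sum_comp A.equivFin.symm fun i : A => g i, Finset.sum_coe_sort]
    rw [hsum D w, hsum D fun i => σ (w i), hsum S w]
    exact h.eq_sum
end

section
/- Let L = ℚ(√d) be a real quadratic field (d ≥ 2 squarefree, embedded in ℝ with √d > 0) with fundamental unit η > 1, let ℓ ∈ ℕ and c = (c_1,…,c_ℓ) ∈ (L^×)^ℓ. For X ≥ 2, let T_{L,ℓ}^c(X) be the number of tuples (u_1,…,u_ℓ) ∈ (O_L^×)^ℓ such that: |Tr_{L/ℚ}(c_1 u_1) + ⋯ + Tr_{L/ℚ}(c_ℓ u_ℓ)| ≤ X; the sum c_1 u_1 + ⋯ + c_ℓ u_ℓ + c_1' u_1' + ⋯ + c_ℓ' u_ℓ' has no vanishing subsum; and |u_i| ≥ 1 for all 1 ≤ i ≤ ℓ. Then T_{L,ℓ}^c(X) = (2 log X / log η)^ℓ + O_{L,ℓ,c}((log X)^{ℓ−1}). -/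
open NumberField IntermediateField

/-- The counting function `T_{L,ℓ}^c(X)`: the number of tuples `(u₁, …, u_ℓ)` of units
with `|Tr(c₁u₁) + ⋯ + Tr(c_ℓu_ℓ)| ≤ X`, such that
`c₁u₁ + ⋯ + c_ℓu_ℓ + c₁'u₁' + ⋯ + c_ℓ'u_ℓ'` has no vanishing subsum and `|u_i| ≥ 1`. -/
noncomputable def TraceSumCount (L : IntermediateField ℚ ℝ) (σ : L ≃ₐ[ℚ] L) (ℓ : ℕ)
    (c : Fin ℓ → L) (X : ℝ) : ℕ :=
  Set.ncard {u : Fin ℓ → (𝓞 L)ˣ |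
    |((∑ i, (c i * ((u i : 𝓞 L) : L) + σ (c i * ((u i : 𝓞 L) : L))) : L) : ℝ)| ≤ X ∧
    NoVanishingSubsum (Sum.elim (fun i : Fin ℓ => c i * ((u i : 𝓞 L) : L))
      (fun i : Fin ℓ => σ (c i * ((u i : 𝓞 L) : L)))) ∧
    ∀ i, 1 ≤ |(((u i : 𝓞 L) : L) : ℝ)|}

open Filter Topology in
/-- If the ratios of the `u i` lie in a set that is discrete away from `0`, then a linear form in the
`u i` without vanishing subsums is bounded below by a constant times `max |u i|`. -/
theorem eventually_le_abs_sum {ι : Type*} [DecidableEq ι] (Q : Set ℝ)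
    (hQ : ∀ ε : ℝ, 0 < ε → (Q ∩ {x | ε ≤ |x| ∧ |x| ≤ 1}).Finite) (s : Finset ι) :
    ∀ c : ι → ℝ, ∀ᶠ δ in 𝓝[>] (0 : ℝ), ∀ u : ι → ℝ, (∀ i j, u i / u j ∈ Q) → (∀ i, u i ≠ 0) →
      (∀ I ⊆ s, I.Nonempty → ∑ i ∈ I, c i * u i ≠ 0) →
      ∀ i ∈ s, δ * |u i| ≤ |∑ i ∈ s, c i * u i| := by
  induction s using Finset.strongInduction with
  | H s ih =>
  intro c
  have small : ∀ a b : ℝ, 0 < b → ∀ᶠ δ in 𝓝[>] (0 : ℝ), δ * a ≤ b := by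
    intro a b hb
    refine Filter.Eventually.filter_mono nhdsWithin_le_nhds ?_
    have : Tendsto (fun δ : ℝ => δ * a) (𝓝 0) (𝓝 (0 * a)) := by
      exact (continuous_id.mul continuous_const).tendsto 0
    rw [zero_mul] at this
    exact (this.eventually (gt_mem_nhds hb)).mono fun _ h => h.le
  obtain ⟨ε, hε, hε0⟩ : ∃ ε : ℝ, (∀ i ∈ s, c i ≠ 0 → ε * ∑ j ∈ s, |c j| ≤ |c i| / 2) ∧ 0 < ε := by
    have h1 : ∀ᶠ ε in 𝓝[>] (0 : ℝ), ∀ i ∈ s, c i ≠ 0 → ε * ∑ j ∈ s, |c j| ≤ |c i| / 2 := by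
      rw [Filter.eventually_all_finset]
      intro i _
      by_cases hi : c i = 0
      · simp [hi]
      · exact (small _ _ (half_pos (abs_pos.mpr hi))).mono fun _ h _ => h
    exact (h1.and self_mem_nhdsWithin).exists
  have h1 : ∀ᶠ δ in 𝓝[>] (0 : ℝ), ∀ i ∈ s, c i ≠ 0 → δ * 1 ≤ |c i| / 2 := by
    rw [Filter.eventually_all_finset]
    intro i _
    by_cases hi : c i = 0
    · simp [hi]
    · exact (small _ _ (half_pos (abs_pos.mpr hi))).mono fun _ h _ => h
  have h2 : ∀ᶠ δ in 𝓝[>] (0 : ℝ), ∀ i ∈ s, ∀ j ∈ s, ∀ v ∈ Q ∩ {x | ε ≤ |x| ∧ |x| ≤ 1},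
      ∀ u : ι → ℝ, (∀ i j, u i / u j ∈ Q) → (∀ i, u i ≠ 0) →
      (∀ I ⊆ s.erase j, I.Nonempty →
        ∑ k ∈ I, Function.update c i (c i + c j * v) k * u k ≠ 0) →
      ∀ k ∈ s.erase j, δ * |u k| ≤
        |∑ k ∈ s.erase j, Function.update c i (c i + c j * v) k * u k| := by
    rw [Filter.eventually_all_finset]
    intro i _
    rw [Filter.eventually_all_finset]
    intro j hj
    rw [Filter.eventually_all_finite (hQ ε hε0)]
    intro v _
    exact ih _ (Finset.erase_ssubset hj) _
  filter_upwards [h1, h2, self_mem_nhdsWithin] with δ h1 h2 hδ u huQ hu0 hnv i hi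
  have hδ : 0 < δ := hδ
  obtain ⟨m, hm, hmax⟩ := s.exists_max_image (fun i => |u i|) ⟨i, hi⟩
  refine (mul_le_mul_of_nonneg_left (hmax i hi) hδ.le).trans ?_
  have hum : 0 < |u m| := abs_pos.mpr (hu0 m)
  by_cases hgap : ∃ j ∈ s, j ≠ m ∧ ε * |u m| ≤ |u j|
  · obtain ⟨j, hj, hjm, hle⟩ := hgap
    have key : ∀ I : Finset ι, j ∉ I → ∑ k ∈ I,
        Function.update c m (c m + c j * (u j / u m)) k * u k =
        ∑ k ∈ (if m ∈ I then insert j I else I), c k * u k := by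
      intro I hjI
      split_ifs with hmI
      · rw [Finset.sum_insert hjI, ← Finset.add_sum_erase _ _ hmI, ← Finset.add_sum_erase _ _ hmI,
          Finset.sum_congr rfl (g := fun k => c k * u k)]
        · have := hu0 m
          simp only [Function.update_self]
          field_simp
          ring
        · intro k hk
          rw [Function.update_of_ne (Finset.ne_of_mem_erase hk)]
      · refine Finset.sum_congr rfl fun k hk => ?_
        rw [Function.update_of_ne (by rintro rfl; exact hmI hk)]
    have h3 := h2 m hm j hj (u j / u m) ⟨huQ j m, ?_, ?_⟩ u huQ hu0 ?_ m
      (Finset.mem_erase.mpr ⟨hjm.symm, hm⟩)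
    · rwa [key _ (Finset.notMem_erase j s), if_pos (Finset.mem_erase.mpr ⟨hjm.symm, hm⟩),
        Finset.insert_erase hj] at h3
    · rwa [abs_div, le_div_iff₀ hum]
    · rw [abs_div, div_le_one hum]
      exact hmax j hj
    · intro I hI hne
      have hjI : j ∉ I := fun h => Finset.notMem_erase j s (hI h)
      rw [key I hjI]
      have hIs : I ⊆ s := hI.trans (Finset.erase_subset j s)
      split_ifs
      · exact hnv _ (Finset.insert_subset hj hIs) (Finset.insert_nonempty j I)
      · exact hnv _ hIs hne
  · push Not at hgap
    have hcm : c m ≠ 0 := by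
      intro h
      exact hnv {m} (by simpa using hm) (by simp) (by simp [h])
    have hrest : |∑ k ∈ s.erase m, c k * u k| ≤ |c m| / 2 * |u m| := by
      calc |∑ k ∈ s.erase m, c k * u k| ≤ ∑ k ∈ s.erase m, |c k| * (ε * |u m|) := by
            refine (Finset.abs_sum_le_sum_abs _ _).trans (Finset.sum_le_sum fun k hk => ?_)
            rw [abs_mul]
            exact mul_le_mul_of_nonneg_left
              (hgap k (Finset.mem_of_mem_erase hk) (Finset.ne_of_mem_erase hk)).le (abs_nonneg _)
        _ ≤ ∑ k ∈ s, |c k| * (ε * |u m|) :=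
            Finset.sum_le_sum_of_subset_of_nonneg (Finset.erase_subset m s)
              fun _ _ _ => by positivity
        _ = ε * (∑ k ∈ s, |c k|) * |u m| := by rw [← Finset.sum_mul]; ring
        _ ≤ |c m| / 2 * |u m| := mul_le_mul_of_nonneg_right (hε m hm hcm) hum.le
    rw [← Finset.add_sum_erase _ _ hm]
    have h4 := abs_sub_abs_le_abs_sub (c m * u m) (-∑ k ∈ s.erase m, c k * u k)
    rw [abs_neg, sub_neg_eq_add, abs_mul] at h4
    have h5 := mul_le_mul_of_nonneg_right (h1 m hm hcm) hum.le
    linarith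

theorem card_filter_sum_eq_zero_le {α M : Type*} [DecidableEq α] [AddCommGroup M] [DecidableEq M]
    {ℓ : ℕ} (B : Finset α) (f : Fin ℓ → α → M) (i : Fin ℓ) (k : ℕ)
    (h : ∀ a, (B.filter fun x => f i x = a).card ≤ k) :
    ((Fintype.piFinset fun _ : Fin ℓ => B).filter fun u => ∑ j, f j (u j) = 0).card ≤
      k * B.card ^ (ℓ - 1) := by
  have hcard : (Fintype.piFinset fun _ : {j : Fin ℓ // j ≠ i} => B).card = B.card ^ (ℓ - 1) := by
    simp [Fintype.card_subtype_compl]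
  rw [← hcard]
  refine Finset.card_le_mul_card_image_of_maps_to (f := fun u j => u j.1) ?_ k ?_
  · intro u hu
    simp only [Finset.mem_filter, Fintype.mem_piFinset] at hu ⊢
    exact fun j => hu.1 j
  · intro r _
    refine le_trans ?_ (h (-∑ j : {j : Fin ℓ // j ≠ i}, f j (r j)))
    refine Finset.card_le_card_of_injOn (fun u => u i) ?_ ?_
    · intro u hu
      simp only [Finset.coe_filter, Finset.mem_filter, Fintype.mem_piFinset, Set.mem_ofPred_eq] at hu ⊢
      refine ⟨hu.1.1 i, ?_⟩
      rw [eq_neg_iff_add_eq_zero, ← hu.1.2, ← hu.2, Fintype.sum_eq_add_sum_subtype_ne _ i]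
    · intro u hu v hv huv
      simp only [Finset.coe_filter, Finset.mem_filter, Set.mem_ofPred_eq] at hu hv
      funext j
      by_cases hj : j = i
      · rw [hj]; exact huv
      · exact congrFun (hu.2.trans hv.2.symm) ⟨j, hj⟩

theorem mul_conj_sq_eq_one (d : ℕ) (σ : ℚ⟮(Real.sqrt d)⟯ ≃ₐ[ℚ] ℚ⟮(Real.sqrt d)⟯)
    (hσ : σ ≠ AlgEquiv.refl) (u : (𝓞 ℚ⟮(Real.sqrt d)⟯)ˣ) :
    (((u : 𝓞 ℚ⟮(Real.sqrt d)⟯) : ℚ⟮(Real.sqrt d)⟯) *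
      σ ((u : 𝓞 ℚ⟮(Real.sqrt d)⟯) : ℚ⟮(Real.sqrt d)⟯)) ^ 2 = 1 := by
  classical
  have hroot : Polynomial.aeval (Real.sqrt d) (Polynomial.X ^ 2 - Polynomial.C (d : ℚ)) = 0 := by
    simp
  have hmonic : (Polynomial.X ^ 2 - Polynomial.C (d : ℚ)).Monic :=
    Polynomial.monic_X_pow_sub_C _ two_ne_zero
  have hint : IsIntegral ℚ (Real.sqrt d) := ⟨_, hmonic, hroot⟩
  have : FiniteDimensional ℚ ℚ⟮(Real.sqrt d)⟯ := adjoin.finiteDimensional hint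
  have : NumberField ℚ⟮(Real.sqrt d)⟯ := ⟨⟩
  have hle : Module.finrank ℚ ℚ⟮(Real.sqrt d)⟯ ≤ 2 := by
    rw [adjoin.finrank hint]
    refine (Polynomial.natDegree_le_of_dvd (minpoly.dvd _ _ hroot) hmonic.ne_zero).trans ?_
    rw [Polynomial.natDegree_X_pow_sub_C]
  have hge := AlgEquiv.card_le (F := ℚ) (K := ℚ⟮(Real.sqrt d)⟯)
  have huniv : (insert AlgEquiv.refl (singleton σ) :
      Finset (ℚ⟮(Real.sqrt d)⟯ ≃ₐ[ℚ] ℚ⟮(Real.sqrt d)⟯)) = Finset.univ := by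
    refine Finset.eq_univ_of_card _ (le_antisymm (Finset.card_le_univ _) ?_)
    rw [Finset.card_pair hσ.symm]
    exact hge.trans hle
  have hcard : Fintype.card (ℚ⟮(Real.sqrt d)⟯ ≃ₐ[ℚ] ℚ⟮(Real.sqrt d)⟯) = 2 := by
    rw [← Finset.card_univ, ← huniv, Finset.card_pair hσ.symm]
  have : IsGalois ℚ ℚ⟮(Real.sqrt d)⟯ := IsGalois.of_card_aut_eq_finrank _ _ (by
    rw [Nat.card_eq_fintype_card]; omega)
  have h1 := Algebra.norm_eq_prod_automorphisms ℚ
    ((u : 𝓞 ℚ⟮(Real.sqrt d)⟯) : ℚ⟮(Real.sqrt d)⟯)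
  rw [← huniv, Finset.prod_pair hσ.symm] at h1
  have h2 := (NumberField.isUnit_iff_norm (K := ℚ⟮(Real.sqrt d)⟯) (x := u)).mp u.isUnit
  rw [RingOfIntegers.coe_norm] at h2
  have h3 : (Algebra.norm ℚ ((u : 𝓞 ℚ⟮(Real.sqrt d)⟯) : ℚ⟮(Real.sqrt d)⟯)) ^ 2 = 1 := by
    rw [← sq_abs, h2, one_pow]
  rw [AlgEquiv.coe_refl, id] at h1
  rw [← h1, ← map_pow, h3, map_one]

/-- The real embedding, as a homomorphism on units. -/
noncomputable def unitEmb (L : IntermediateField ℚ ℝ) : (𝓞 L)ˣ →* ℝ :=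
  (((algebraMap L ℝ).comp (algebraMap (𝓞 L) L) : 𝓞 L →+* ℝ) : 𝓞 L →* ℝ).comp (Units.coeHom (𝓞 L))

theorem unitEmb_injective (L : IntermediateField ℚ ℝ) : Function.Injective (unitEmb L) := by
  intro u v h
  exact Units.ext (RingOfIntegers.ext (Subtype.ext h))

theorem unitEmb_neg (L : IntermediateField ℚ ℝ) (u : (𝓞 L)ˣ) : unitEmb L (-u) = -unitEmb L u := by
  simp [unitEmb]

theorem unitEmb_ne_zero (L : IntermediateField ℚ ℝ) (u : (𝓞 L)ˣ) : unitEmb L u ≠ 0 :=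
  (u.isUnit.map ((algebraMap L ℝ).comp (algebraMap (𝓞 L) L))).ne_zero

theorem exists_eq_pow_or_neg_pow {L : IntermediateField ℚ ℝ} {η : (𝓞 L)ˣ} (hη : 1 < unitEmb L η)
    (hfund : ∀ ε : (𝓞 L)ˣ, 1 < unitEmb L ε → unitEmb L η ≤ unitEmb L ε)
    (u : (𝓞 L)ˣ) (hu : 1 ≤ |unitEmb L u|) : ∃ n : ℕ, u = η ^ n ∨ u = -η ^ n := by
  have pos : ∀ u : (𝓞 L)ˣ, 1 ≤ unitEmb L u → ∃ n : ℕ, u = η ^ n := by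
    intro u hu
    obtain ⟨n, hn, hn'⟩ := exists_nat_pow_near hu hη
    refine ⟨n, ?_⟩
    have hmul : unitEmb L (u * (η ^ n)⁻¹) * unitEmb L η ^ n = unitEmb L u := by
      rw [← map_pow, ← map_mul, inv_mul_cancel_right]
    have hpos : 0 < unitEmb L η ^ n := by positivity
    have hle : ¬ 1 < unitEmb L (u * (η ^ n)⁻¹) := by
      intro h
      have := mul_le_mul_of_nonneg_right (hfund _ h) hpos.le
      rw [hmul, ← pow_succ'] at this
      linarith
    have hge : 1 ≤ unitEmb L (u * (η ^ n)⁻¹) := by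
      refine le_of_mul_le_mul_right ?_ hpos
      rwa [one_mul, hmul]
    have h1 : u * (η ^ n)⁻¹ = 1 :=
      unitEmb_injective L (by rw [map_one]; exact le_antisymm (not_lt.mp hle) hge)
    exact mul_inv_eq_one.mp h1
  rcases le_abs.mp hu with h | h
  · obtain ⟨n, hn⟩ := pos u h
    exact ⟨n, Or.inl hn⟩
  · obtain ⟨n, hn⟩ := pos (-u) (by rwa [unitEmb_neg])
    exact ⟨n, Or.inr (by rw [← hn, neg_neg])⟩

theorem exists_unit_box {L : IntermediateField ℚ ℝ} {η : (𝓞 L)ˣ} (hη : 1 < unitEmb L η)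
    (hfund : ∀ ε : (𝓞 L)ˣ, 1 < unitEmb L ε → unitEmb L η ≤ unitEmb L ε) (Y : ℝ) :
    ∃ B : Finset (𝓞 L)ˣ, (∀ u, u ∈ B ↔ 1 ≤ |unitEmb L u| ∧ |unitEmb L u| ≤ Y) ∧
      (Y < 1 → B.card = 0) ∧
      (1 ≤ Y → |(B.card : ℝ) - 2 * Real.log Y / Real.log (unitEmb L η)| ≤ 2) := by
  classical
  rcases lt_or_ge Y 1 with hY | hY
  · refine ⟨∅, fun u => ?_, by simp, fun h => absurd h hY.not_ge⟩
    simp only [Finset.notMem_empty, false_iff, not_and, not_le]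
    exact fun h => hY.trans_le h
  have hη0 : 0 < unitEmb L η := by linarith
  have hlog : 0 < Real.log (unitEmb L η) := Real.log_pos hη
  have hlogY : 0 ≤ Real.log Y / Real.log (unitEmb L η) := div_nonneg (Real.log_nonneg hY) hlog.le
  set m := ⌊Real.log Y / Real.log (unitEmb L η)⌋₊ with hm
  have hpow : ∀ n : ℕ, unitEmb L η ^ n ≤ Y ↔ n < m + 1 := by
    intro n
    rw [Nat.lt_succ_iff, hm, Nat.le_floor_iff hlogY, le_div_iff₀ hlog, ← Real.log_pow,
      Real.log_le_log_iff (by positivity) (by linarith)]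
  have hinj : Function.Injective fun n : ℕ => η ^ n := by
    intro a b hab
    have := congrArg (unitEmb L) hab
    simp only [map_pow] at this
    exact pow_right_injective₀ hη0 hη.ne' this
  have habs : ∀ n : ℕ, |unitEmb L (η ^ n)| = unitEmb L η ^ n := by
    intro n
    rw [map_pow, abs_of_pos (by positivity)]
  have hone : ∀ n : ℕ, 1 ≤ unitEmb L η ^ n := fun n => one_le_pow₀ hη.le
  refine ⟨(Finset.range (m + 1)).image (fun n => η ^ n) ∪
    (Finset.range (m + 1)).image (fun n => -η ^ n), fun u => ?_,
    fun h => absurd h hY.not_gt, fun _ => ?_⟩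
  · simp only [Finset.mem_union, Finset.mem_image, Finset.mem_range]
    constructor
    · rintro (⟨n, hn, rfl⟩ | ⟨n, hn, rfl⟩)
      · rw [habs]
        exact ⟨hone n, (hpow n).mpr hn⟩
      · rw [unitEmb_neg, abs_neg, habs]
        exact ⟨hone n, (hpow n).mpr hn⟩
    · rintro ⟨h1, h2⟩
      obtain ⟨n, rfl | rfl⟩ := exists_eq_pow_or_neg_pow hη hfund u h1
      · rw [habs, hpow] at h2
        exact Or.inl ⟨n, h2, rfl⟩
      · rw [unitEmb_neg, abs_neg, habs, hpow] at h2
        exact Or.inr ⟨n, h2, rfl⟩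
  · rw [Finset.card_union_of_disjoint, Finset.card_image_of_injective _ hinj,
      Finset.card_image_of_injective _ (f := fun n => -η ^ n) (neg_injective.comp hinj),
      Finset.card_range]
    · have h1 := Nat.floor_le hlogY
      have h2 := Nat.lt_floor_add_one (Real.log Y / Real.log (unitEmb L η))
      rw [← hm] at h1 h2
      rw [mul_div_assoc, abs_le]
      push_cast
      constructor <;> linarith
    · rw [Finset.disjoint_left]
      simp only [Finset.mem_image, not_exists, not_and]
      rintro _ ⟨a, _, rfl⟩ b _ hab
      have := congrArg (unitEmb L) hab
      rw [unitEmb_neg, map_pow, map_pow] at this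
      linarith [hone a, hone b]

/-- The number of units `u` with `1 ≤ |u| ≤ a X` is `2 log X / log η + O(1)`. -/
theorem exists_unit_box_asymptotic {L : IntermediateField ℚ ℝ} {η : (𝓞 L)ˣ}
    (hη : 1 < unitEmb L η)
    (hfund : ∀ ε : (𝓞 L)ˣ, 1 < unitEmb L ε → unitEmb L η ≤ unitEmb L ε) (a : ℝ) (ha : 0 < a) :
    ∃ K : ℝ, 0 ≤ K ∧ ∀ X : ℝ, 2 ≤ X → ∃ B : Finset (𝓞 L)ˣ,
      (∀ u, u ∈ B ↔ 1 ≤ |unitEmb L u| ∧ |unitEmb L u| ≤ a * X) ∧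
      |(B.card : ℝ) - 2 * Real.log X / Real.log (unitEmb L η)| ≤ K := by
  have hlog : 0 < Real.log (unitEmb L η) := Real.log_pos hη
  refine ⟨2 + 2 * (|Real.log a| / Real.log (unitEmb L η)), by positivity, fun X hX => ?_⟩
  obtain ⟨B, hB, h0, h1⟩ := exists_unit_box hη hfund (a * X)
  refine ⟨B, hB, ?_⟩
  have hX0 : 0 < Real.log X := Real.log_pos (by linarith)
  have hmul : Real.log (a * X) = Real.log a + Real.log X :=
    Real.log_mul ha.ne' (by linarith)
  have hX1 : 0 < Real.log X / Real.log (unitEmb L η) := div_pos hX0 hlog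
  have hup : Real.log a / Real.log (unitEmb L η) ≤ |Real.log a| / Real.log (unitEmb L η) :=
    div_le_div_of_nonneg_right (le_abs_self _) hlog.le
  have hlow : -(Real.log a / Real.log (unitEmb L η)) ≤ |Real.log a| / Real.log (unitEmb L η) := by
    rw [← neg_div]
    exact div_le_div_of_nonneg_right (neg_le_abs _) hlog.le
  rcases lt_or_ge (a * X) 1 with h | h
  · have hneg : Real.log a + Real.log X < 0 := by
      rw [← hmul]
      exact Real.log_neg (mul_pos ha (by linarith)) h
    have := div_neg_of_neg_of_pos hneg hlog
    rw [add_div] at this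
    rw [h0 h, mul_div_assoc, Nat.cast_zero, abs_le]
    constructor <;> linarith
  · have := h1 h
    rw [hmul, mul_div_assoc, add_div, abs_le] at this
    rw [mul_div_assoc, abs_le]
    constructor <;> linarith [this.1, this.2]

theorem card_filter_add_conj_eq_le {L : IntermediateField ℚ ℝ} (σ : L ≃ₐ[ℚ] L)
    (hσ : ∀ u : (𝓞 L)ˣ, (((u : 𝓞 L) : L) * σ ((u : 𝓞 L) : L)) ^ 2 = 1) [DecidableEq L]
    (B : Finset (𝓞 L)ˣ) (c e a : L) (h : c ≠ 0 ∨ e ≠ 0) :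
    (B.filter fun u : (𝓞 L)ˣ => c * ((u : 𝓞 L) : L) + e * σ ((u : 𝓞 L) : L) = a).card ≤ 4 := by
  classical
  let p : Polynomial L := (Polynomial.C c * Polynomial.X ^ 2 - Polynomial.C a * Polynomial.X) ^ 2 -
    Polynomial.C (e ^ 2)
  have hp : p ≠ 0 := by
    intro hp
    have h0 : e = 0 := by simpa [p] using congrArg (Polynomial.eval 0) hp
    have h1 : c = 0 := by
      have h2 : (Polynomial.C c * Polynomial.X ^ 2 - Polynomial.C a * Polynomial.X) = 0 := by
        simpa [p, h0] using hp
      simpa [Polynomial.coeff_X] using congrArg (fun q => Polynomial.coeff q 2) h2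
    tauto
  have hdeg : p.natDegree ≤ 4 := by
    simp only [p]
    compute_degree
  refine le_trans ?_ ((Multiset.toFinset_card_le p.roots).trans
    ((Polynomial.card_roots' p).trans hdeg))
  refine Finset.card_le_card_of_injOn (fun u : (𝓞 L)ˣ => ((u : 𝓞 L) : L)) ?_ ?_
  · intro u hu
    simp only [Finset.coe_filter, Set.mem_ofPred_eq] at hu
    simp only [Finset.mem_coe, Multiset.mem_toFinset, Polynomial.mem_roots hp,
      Polynomial.IsRoot.def, p]
    have h3 := hσ u
    rw [← hu.2]
    simp only [Polynomial.eval_sub, Polynomial.eval_pow, Polynomial.eval_mul, Polynomial.eval_C,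
      Polynomial.eval_X]
    linear_combination e ^ 2 * h3
  · intro u _ v _ huv
    exact Units.ext (RingOfIntegers.ext huv)

/-- Tuples of units from a finite set having a vanishing subsum lie on boundedly many
hypersurfaces. -/
theorem card_filter_not_noVanishingSubsum_le {L : IntermediateField ℚ ℝ} (σ : L ≃ₐ[ℚ] L)
    (hσ : ∀ u : (𝓞 L)ˣ, (((u : 𝓞 L) : L) * σ ((u : 𝓞 L) : L)) ^ 2 = 1) {ℓ : ℕ}
    (c : Fin ℓ → L) (hc : ∀ i, c i ≠ 0) (B : Finset (𝓞 L)ˣ) [DecidablePred fun u :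
      Fin ℓ → (𝓞 L)ˣ => ¬ NoVanishingSubsum (Sum.elim (fun i : Fin ℓ => c i * ((u i : 𝓞 L) : L))
        (fun i : Fin ℓ => σ (c i * ((u i : 𝓞 L) : L))))] :
    ((Fintype.piFinset fun _ : Fin ℓ => B).filter fun u =>
      ¬ NoVanishingSubsum (Sum.elim (fun i : Fin ℓ => c i * ((u i : 𝓞 L) : L))
        (fun i : Fin ℓ => σ (c i * ((u i : 𝓞 L) : L))))).card ≤
      Fintype.card (Finset (Fin ℓ ⊕ Fin ℓ)) * (4 * B.card ^ (ℓ - 1)) := by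
  classical
  let α (I : Finset (Fin ℓ ⊕ Fin ℓ)) (i : Fin ℓ) : L := if Sum.inl i ∈ I then c i else 0
  let β (I : Finset (Fin ℓ ⊕ Fin ℓ)) (i : Fin ℓ) : L := if Sum.inr i ∈ I then σ (c i) else 0
  let f (I : Finset (Fin ℓ ⊕ Fin ℓ)) (i : Fin ℓ) (u : (𝓞 L)ˣ) : L :=
    α I i * ((u : 𝓞 L) : L) + β I i * σ ((u : 𝓞 L) : L)
  have hsum : ∀ (I : Finset (Fin ℓ ⊕ Fin ℓ)) (u : Fin ℓ → (𝓞 L)ˣ),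
      ∑ k ∈ I, Sum.elim (fun i : Fin ℓ => c i * ((u i : 𝓞 L) : L))
        (fun i : Fin ℓ => σ (c i * ((u i : 𝓞 L) : L))) k = ∑ i, f I i (u i) := by
    intro I u
    rw [← Finset.univ_inter I, ← Finset.sum_ite_mem, Fintype.sum_sum_type,
      ← Finset.sum_add_distrib]
    refine Finset.sum_congr rfl fun i _ => ?_
    simp only [f, α, β, Sum.elim_inl, Sum.elim_inr, ite_mul, zero_mul, map_mul,
      Finset.univ_inter]
  calc _ ≤ ((Finset.univ.filter fun I : Finset (Fin ℓ ⊕ Fin ℓ) => I.Nonempty).biUnion fun I =>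
        (Fintype.piFinset fun _ : Fin ℓ => B).filter fun u => ∑ i, f I i (u i) = 0).card := by
        refine Finset.card_le_card fun u hu => ?_
        rw [Finset.mem_filter] at hu
        obtain ⟨hu, hv⟩ := hu
        simp only [NoVanishingSubsum] at hv
        push Not at hv
        obtain ⟨I, hI, h0⟩ := hv
        rw [Finset.mem_biUnion]
        exact ⟨I, by simpa using hI, Finset.mem_filter.mpr ⟨hu, by rw [← hsum]; exact h0⟩⟩
    _ ≤ (Finset.univ.filter fun I : Finset (Fin ℓ ⊕ Fin ℓ) => I.Nonempty).card *
        (4 * B.card ^ (ℓ - 1)) := by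
        refine Finset.card_biUnion_le_card_mul _ _ _ fun I hI => ?_
        obtain ⟨k, hk⟩ := (Finset.mem_filter.mp hI).2
        rcases k with i | i
        · refine card_filter_sum_eq_zero_le B (f I) i 4 fun a =>
            card_filter_add_conj_eq_le σ hσ B _ _ a (Or.inl ?_)
          simp [α, hk, hc i]
        · refine card_filter_sum_eq_zero_le B (f I) i 4 fun a =>
            card_filter_add_conj_eq_le σ hσ B _ _ a (Or.inr ?_)
          simp [β, hk, hc i]
    _ ≤ _ := Nat.mul_le_mul_right _ (Finset.card_filter_le _ _)

theorem abs_conj_le_one {L : IntermediateField ℚ ℝ} (σ : L ≃ₐ[ℚ] L)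
    (hσ : ∀ u : (𝓞 L)ˣ, (((u : 𝓞 L) : L) * σ ((u : 𝓞 L) : L)) ^ 2 = 1) (u : (𝓞 L)ˣ)
    (hu : 1 ≤ |unitEmb L u|) : |((σ ((u : 𝓞 L) : L) : L) : ℝ)| ≤ 1 := by
  have h1 : (unitEmb L u * ((σ ((u : 𝓞 L) : L) : L) : ℝ)) ^ 2 = 1 := by
    have h := congrArg (algebraMap L ℝ) (hσ u)
    rw [map_pow, map_mul, map_one] at h
    exact h
  have h3 : |unitEmb L u| * |((σ ((u : 𝓞 L) : L) : L) : ℝ)| = 1 := by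
    rw [← abs_mul]
    exact (pow_eq_one_iff_of_nonneg (abs_nonneg _) two_ne_zero).mp (by rw [sq_abs, h1])
  nlinarith [abs_nonneg ((σ ((u : 𝓞 L) : L) : L) : ℝ)]

/-- The embedded trace sum, separated into its principal and its conjugate part. -/
theorem coe_sum_add_conj {L : IntermediateField ℚ ℝ} (σ : L ≃ₐ[ℚ] L) {ℓ : ℕ} (c : Fin ℓ → L)
    (u : Fin ℓ → (𝓞 L)ˣ) :
    ((∑ i, (c i * ((u i : 𝓞 L) : L) + σ (c i * ((u i : 𝓞 L) : L))) : L) : ℝ) =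
      ∑ i, (c i : ℝ) * unitEmb L (u i) +
        ∑ i, ((σ (c i) : L) : ℝ) * ((σ ((u i : 𝓞 L) : L) : L) : ℝ) := by
  have h : ∀ x : L, (x : ℝ) = algebraMap L ℝ x := fun _ => rfl
  simp only [h, map_sum, map_add, map_mul, Finset.sum_add_distrib]
  rfl

theorem abs_sum_mul_conj_le {L : IntermediateField ℚ ℝ} (σ : L ≃ₐ[ℚ] L)
    (hσ : ∀ u : (𝓞 L)ˣ, (((u : 𝓞 L) : L) * σ ((u : 𝓞 L) : L)) ^ 2 = 1) {ℓ : ℕ} (c : Fin ℓ → L)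
    (u : Fin ℓ → (𝓞 L)ˣ) (hu : ∀ i, 1 ≤ |unitEmb L (u i)|) :
    |∑ i, ((σ (c i) : L) : ℝ) * ((σ ((u i : 𝓞 L) : L) : L) : ℝ)| ≤
      ∑ i, |((σ (c i) : L) : ℝ)| := by
  refine (Finset.abs_sum_le_sum_abs _ _).trans (Finset.sum_le_sum fun i _ => ?_)
  rw [abs_mul]
  exact mul_le_of_le_one_right (abs_nonneg _) (abs_conj_le_one σ hσ _ (hu i))

theorem exists_abs_le_mul_of_noVanishingSubsum {L : IntermediateField ℚ ℝ} (σ : L ≃ₐ[ℚ] L)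
    (hσ : ∀ u : (𝓞 L)ˣ, (((u : 𝓞 L) : L) * σ ((u : 𝓞 L) : L)) ^ 2 = 1)
    {η : (𝓞 L)ˣ} (hη : 1 < unitEmb L η)
    (hfund : ∀ ε : (𝓞 L)ˣ, 1 < unitEmb L ε → unitEmb L η ≤ unitEmb L ε)
    {ℓ : ℕ} (c : Fin ℓ → L) :
    ∃ a : ℝ, 0 < a ∧ ∀ X : ℝ, 1 ≤ X → ∀ u : Fin ℓ → (𝓞 L)ˣ,
      |((∑ i, (c i * ((u i : 𝓞 L) : L) + σ (c i * ((u i : 𝓞 L) : L))) : L) : ℝ)| ≤ X →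
      NoVanishingSubsum (Sum.elim (fun i : Fin ℓ => c i * ((u i : 𝓞 L) : L))
        (fun i : Fin ℓ => σ (c i * ((u i : 𝓞 L) : L)))) →
      (∀ i, 1 ≤ |unitEmb L (u i)|) → ∀ i, |unitEmb L (u i)| ≤ a * X := by
  have hQ : ∀ ε : ℝ, 0 < ε →
      (Set.range (unitEmb L) ∩ {x | ε ≤ |x| ∧ |x| ≤ 1}).Finite := by
    intro ε hε
    obtain ⟨B, hB, -⟩ := exists_unit_box hη hfund ε⁻¹
    refine (B.finite_toSet.image fun u => unitEmb L u⁻¹).subset ?_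
    rintro _ ⟨⟨u, rfl⟩, h1, h2⟩
    have hpos : 0 < |unitEmb L u| := hε.trans_le h1
    have hinv : unitEmb L u⁻¹ = (unitEmb L u)⁻¹ :=
      eq_inv_of_mul_eq_one_left (by rw [← map_mul, inv_mul_cancel, map_one])
    refine ⟨u⁻¹, (hB _).mpr ?_, by simp only [inv_inv]⟩
    rw [hinv, abs_inv]
    exact ⟨(one_le_inv₀ hpos).mpr h2, inv_anti₀ hε h1⟩
  obtain ⟨δ, hδ, hδ0⟩ := ((eventually_le_abs_sum (Set.range (unitEmb L)) hQ Finset.univ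
    (fun i => (c i : ℝ))).and self_mem_nhdsWithin).exists
  have hδ0 : 0 < δ := hδ0
  set S := ∑ i, |((σ (c i) : L) : ℝ)| with hS
  have hS0 : 0 ≤ S := Finset.sum_nonneg fun _ _ => abs_nonneg _
  refine ⟨(1 + S) / δ, by positivity, fun X hX u hsum hnv hu i => ?_⟩
  rw [coe_sum_add_conj] at hsum
  have hconj := abs_sum_mul_conj_le σ hσ c u hu
  have hle : |∑ i, (c i : ℝ) * unitEmb L (u i)| ≤ X + S := by
    have := abs_add_le (∑ i, (c i : ℝ) * unitEmb L (u i) +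
        ∑ i, ((σ (c i) : L) : ℝ) * ((σ ((u i : 𝓞 L) : L) : L) : ℝ))
        (-∑ i, ((σ (c i) : L) : ℝ) * ((σ ((u i : 𝓞 L) : L) : L) : ℝ))
    rw [add_neg_cancel_right, abs_neg] at this
    linarith
  have hmain := hδ (fun i => unitEmb L (u i)) ?_ (fun i => unitEmb_ne_zero L _) ?_ i
    (Finset.mem_univ i)
  · rw [div_mul_eq_mul_div, le_div_iff₀ hδ0]
    nlinarith
  · intro i j
    refine ⟨u i * (u j)⁻¹, ?_⟩
    rw [eq_div_iff (unitEmb_ne_zero L _), ← map_mul, inv_mul_cancel_right]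
  · intro I _ hI h0
    refine hnv (I.map Function.Embedding.inl) (by simpa using hI) ?_
    rw [Finset.sum_map]
    apply (algebraMap L ℝ).injective
    rw [map_zero, map_sum, ← h0]
    refine Finset.sum_congr rfl fun i _ => ?_
    simp only [Function.Embedding.inl_apply, Sum.elim_inl, map_mul]
    rfl

theorem exists_abs_trace_sum_le {L : IntermediateField ℚ ℝ} (σ : L ≃ₐ[ℚ] L)
    (hσ : ∀ u : (𝓞 L)ˣ, (((u : 𝓞 L) : L) * σ ((u : 𝓞 L) : L)) ^ 2 = 1)
    {ℓ : ℕ} (c : Fin ℓ → L) :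
    ∃ b : ℝ, 0 < b ∧ ∀ (X : ℝ) (u : Fin ℓ → (𝓞 L)ˣ), Nonempty (Fin ℓ) →
      (∀ i, 1 ≤ |unitEmb L (u i)| ∧ |unitEmb L (u i)| ≤ b * X) →
      |((∑ i, (c i * ((u i : 𝓞 L) : L) + σ (c i * ((u i : 𝓞 L) : L))) : L) : ℝ)| ≤ X := by
  set S := ∑ i, |((σ (c i) : L) : ℝ)| with hS
  set R := ∑ i, |(c i : ℝ)| with hR
  have hS0 : 0 ≤ S := Finset.sum_nonneg fun _ _ => abs_nonneg _
  have hR0 : 0 ≤ R := Finset.sum_nonneg fun _ _ => abs_nonneg _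
  refine ⟨1 / (1 + R + S), by positivity, fun X u ⟨i₀⟩ hu => ?_⟩
  rw [coe_sum_add_conj]
  set b := 1 / (1 + R + S) with hb
  have hconj := abs_sum_mul_conj_le σ hσ c u fun i => (hu i).1
  have hbX : 1 ≤ b * X := (hu i₀).1.trans (hu i₀).2
  have hmain : |∑ i, (c i : ℝ) * unitEmb L (u i)| ≤ R * (b * X) := by
    rw [hR, Finset.sum_mul]
    refine (Finset.abs_sum_le_sum_abs _ _).trans (Finset.sum_le_sum fun i _ => ?_)
    rw [abs_mul]
    exact mul_le_mul_of_nonneg_left (hu i).2 (abs_nonneg _)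
  have hbS : (1 + R + S) * (b * X) = X := by
    rw [hb]
    field_simp
  refine (abs_add_le _ _).trans ?_
  nlinarith

theorem abs_traceSumCount_sub_le {L : IntermediateField ℚ ℝ} (σ : L ≃ₐ[ℚ] L)
    (hσ : ∀ u : (𝓞 L)ˣ, (((u : 𝓞 L) : L) * σ ((u : 𝓞 L) : L)) ^ 2 = 1)
    {η : (𝓞 L)ˣ} (hη : 1 < unitEmb L η)
    (hfund : ∀ ε : (𝓞 L)ˣ, 1 < unitEmb L ε → unitEmb L η ≤ unitEmb L ε)
    {ℓ : ℕ} (hℓ : 1 ≤ ℓ) (c : Fin ℓ → L) (hc : ∀ i, c i ≠ 0) :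
    ∃ C : ℝ, 0 < C ∧ ∀ X : ℝ, 2 ≤ X →
      |(TraceSumCount L σ ℓ c X : ℝ) - (2 * Real.log X / Real.log (unitEmb L η)) ^ ℓ|
        ≤ C * Real.log X ^ (ℓ - 1) := by
  classical
  obtain ⟨a, ha, hupper⟩ := exists_abs_le_mul_of_noVanishingSubsum σ hσ hη hfund c
  obtain ⟨b, hb, hlower⟩ := exists_abs_trace_sum_le σ hσ c
  obtain ⟨K₁, hK₁, hA⟩ := exists_unit_box_asymptotic hη hfund a ha
  obtain ⟨K₂, hK₂, hB⟩ := exists_unit_box_asymptotic hη hfund b hb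
  have hlog : 0 < Real.log (unitEmb L η) := Real.log_pos hη
  have hlog2 : 0 < Real.log 2 := Real.log_pos one_lt_two
  set K := K₁ + K₂ with hK
  have hK0 : 0 ≤ K := by positivity
  set D := 2 / Real.log (unitEmb L η) + K / Real.log 2 with hD
  have hD0 : 0 ≤ D := by positivity
  set M : ℝ := (Fintype.card (Finset (Fin ℓ ⊕ Fin ℓ)) : ℝ) * 4 with hM
  have hM0 : 0 ≤ M := by positivity
  refine ⟨K * ℓ * D ^ (ℓ - 1) + M * D ^ (ℓ - 1) + 1, by positivity, fun X hX => ?_⟩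
  obtain ⟨A, hAmem, hAcard⟩ := hA X hX
  obtain ⟨B, hBmem, hBcard⟩ := hB X hX
  have hlogX : Real.log 2 ≤ Real.log X := Real.log_le_log two_pos hX
  set t := 2 * Real.log X / Real.log (unitEmb L η) with ht
  have hlogX0 : 0 ≤ Real.log X := hlog2.le.trans hlogX
  have ht0 : 0 ≤ t := by positivity
  have htK : t + K ≤ D * Real.log X := by
    have h1 : K ≤ K / Real.log 2 * Real.log X := by
      rw [div_mul_eq_mul_div, le_div_iff₀ hlog2]
      exact mul_le_mul_of_nonneg_left hlogX hK0
    rw [hD, ht, add_mul, div_mul_eq_mul_div]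
    linarith
  have hpow : ∀ N : ℝ, 0 ≤ N → |N - t| ≤ K → N ≤ D * Real.log X ∧
      |N ^ ℓ - t ^ ℓ| ≤ K * ℓ * D ^ (ℓ - 1) * Real.log X ^ (ℓ - 1) := by
    intro N hN hNt
    have hND : N ≤ D * Real.log X := by linarith [(abs_le.mp hNt).2]
    refine ⟨hND, (abs_pow_sub_pow_le N t ℓ).trans ?_⟩
    rw [mul_assoc (K * ℓ), ← mul_pow, abs_of_nonneg hN, abs_of_nonneg ht0]
    have hmax : max N t ≤ D * Real.log X := max_le hND (by linarith)
    gcongr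
  obtain ⟨-, hA2⟩ := hpow A.card (Nat.cast_nonneg _) (hAcard.trans (by linarith))
  obtain ⟨hB1, hB2⟩ := hpow B.card (Nat.cast_nonneg _) (hBcard.trans (by linarith))
  have hTA : TraceSumCount L σ ℓ c X ≤ A.card ^ ℓ := by
    rw [← Fintype.card_piFinset_const, ← Set.ncard_coe_finset]
    refine Set.ncard_le_ncard ?_ (Finset.finite_toSet _)
    rintro u ⟨h1, h2, h3⟩
    rw [Finset.mem_coe, Fintype.mem_piFinset]
    exact fun i => (hAmem _).mpr ⟨h3 i, hupper X (by linarith) u h1 h2 h3 i⟩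
  have hTB : B.card ^ ℓ ≤ TraceSumCount L σ ℓ c X +
      Fintype.card (Finset (Fin ℓ ⊕ Fin ℓ)) * (4 * B.card ^ (ℓ - 1)) := by
    refine le_trans ?_ (Nat.add_le_add_left
      (card_filter_not_noVanishingSubsum_le σ hσ c hc B) _)
    rw [← Fintype.card_piFinset_const, ← Finset.card_filter_add_card_filter_not (fun u =>
      NoVanishingSubsum (Sum.elim (fun i : Fin ℓ => c i * ((u i : 𝓞 L) : L))
        (fun i : Fin ℓ => σ (c i * ((u i : 𝓞 L) : L)))))]
    refine Nat.add_le_add_right ?_ _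
    rw [← Set.ncard_coe_finset]
    refine Set.ncard_le_ncard ?_ ?_
    · intro u hu
      rw [Finset.mem_coe, Finset.mem_filter, Fintype.mem_piFinset] at hu
      have hbox := fun i => (hBmem _).mp (hu.1 i)
      exact ⟨hlower X u ⟨⟨0, hℓ⟩⟩ hbox, hu.2, fun i => (hbox i).1⟩
    · refine (Fintype.piFinset fun _ : Fin ℓ => A).finite_toSet.subset ?_
      rintro u ⟨h1, h2, h3⟩
      rw [Finset.mem_coe, Fintype.mem_piFinset]
      exact fun i => (hAmem _).mpr ⟨h3 i, hupper X (by linarith) u h1 h2 h3 i⟩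
  have hTA' : (TraceSumCount L σ ℓ c X : ℝ) ≤ (A.card : ℝ) ^ ℓ := by exact_mod_cast hTA
  have hTB' : (B.card : ℝ) ^ ℓ ≤ TraceSumCount L σ ℓ c X + M * (B.card : ℝ) ^ (ℓ - 1) := by
    rw [hM, mul_assoc]
    exact_mod_cast hTB
  have hBM : M * (B.card : ℝ) ^ (ℓ - 1) ≤ M * D ^ (ℓ - 1) * Real.log X ^ (ℓ - 1) := by
    rw [mul_assoc M, ← mul_pow]
    gcongr
  have hM1 : 0 ≤ M * D ^ (ℓ - 1) * Real.log X ^ (ℓ - 1) := by positivity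
  have hone : 0 ≤ Real.log X ^ (ℓ - 1) := by positivity
  rw [abs_le] at hA2 hB2 ⊢
  rw [add_mul, add_mul, one_mul]
  constructor <;> linarith [hA2.2, hB2.1]

/-- Proposition 7: the asymptotic formula
`T_{L,ℓ}^c(X) = (2 log X / log η)^ℓ + O((log X)^{ℓ-1})`. -/
theorem trace_sum_count_asymptotic
    (d : ℕ) (hd : 2 ≤ d) (hsf : Squarefree d)
    (L : IntermediateField ℚ ℝ) (hL : L = ℚ⟮(Real.sqrt d)⟯)
    (σ : L ≃ₐ[ℚ] L) (hσ : σ ≠ AlgEquiv.refl)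
    (η : (𝓞 L)ˣ) (hη : 1 < emb L η)
    (hfund : ∀ ε : (𝓞 L)ˣ, 1 < emb L ε → emb L η ≤ emb L ε)
    (ℓ : ℕ) (hℓ : 1 ≤ ℓ) (c : Fin ℓ → L) (hc : ∀ i, c i ≠ 0) :
    ∃ C : ℝ, 0 < C ∧ ∀ X : ℝ, 2 ≤ X →
      |(TraceSumCount L σ ℓ c X : ℝ) - (2 * Real.log X / Real.log (emb L η)) ^ ℓ|
        ≤ C * Real.log X ^ (ℓ - 1) := by
  subst hL
  exact abs_traceSumCount_sub_le σ (mul_conj_sq_eq_one d σ hσ) hη hfund hℓ c hc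
end
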